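/- Threshold blowup (Theorem 1.2(ii), nonexistence form): there is no regular solution u of the cubic–quintic NLS on the interval [0, ∞), radial in x, such that E(u(0,·)) = E^c(W) and ‖∇u(0,·)‖_{L²}² > ‖∇W‖_{L²}². -/

import Mathlib

open MeasureTheory Complex
open scoped BigOperators ENNReal

noncomputable section

abbrev E3 := EuclideanSpace ℝ (Fin 3)

/-- The Aubin–Talenti ground state `W(x) = (1 + |x|²/3)^(-1/2)`. -/
def W (x : E3) : ℝ := (1 + ‖x‖ ^ 2 / 3) ^ (-(1 : ℝ) / 2)

/-- `W` viewed as a complex-valued function. -/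
def Wc (x : E3) : ℂ := (W x : ℂ)

/-- Standard basis vectors of ℝ³. -/
def e3 (i : Fin 3) : E3 := EuclideanSpace.single i 1

/-- Partial derivative of a real-valued function. -/
def pdR (i : Fin 3) (f : E3 → ℝ) (x : E3) : ℝ := fderiv ℝ f x (e3 i)

/-- Partial derivative of a complex-valued function. -/
def pdC (i : Fin 3) (f : E3 → ℂ) (x : E3) : ℂ := fderiv ℝ f x (e3 i)

/-- Squared gradient `|∇f|²` of a real-valued function. -/
def gradSqR (f : E3 → ℝ) (x : E3) : ℝ := ∑ i, (pdR i f x) ^ 2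

/-- Squared gradient `|∇f|²` of a complex-valued function. -/
def gradSqC (f : E3 → ℂ) (x : E3) : ℝ := ∑ i, ‖pdC i f x‖ ^ 2

/-- Laplacian of a real-valued function. -/
def lapR (f : E3 → ℝ) (x : E3) : ℝ := ∑ i, pdR i (pdR i f) x

/-- Laplacian of a complex-valued function. -/
def lapC (f : E3 → ℂ) (x : E3) : ℂ := ∑ i, pdC i (pdC i f) x

/-- Quintic (energy-critical) energy `E^c`. -/
def Ecrit (f : E3 → ℂ) : ℝ := ∫ x : E3, ((1:ℝ)/2 * gradSqC f x - 1/6 * ‖f x‖ ^ 6)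

/-- Cubic–quintic energy `E`. -/
def Ecq (f : E3 → ℂ) : ℝ :=
  ∫ x : E3, ((1:ℝ)/2 * gradSqC f x - 1/6 * ‖f x‖ ^ 6 + 1/4 * ‖f x‖ ^ 4)

/-- Regular solutions of the cubic–quintic NLS on an interval `I ⊆ ℝ`. -/
def IsRegularSolution (I : Set ℝ) (u : ℝ → E3 → ℂ) : Prop :=
  ContDiffOn ℝ (⊤ : ℕ∞) (fun p : ℝ × E3 => u p.1 p.2) (I ×ˢ Set.univ) ∧
  (∀ t ∈ I, ∀ x : E3, Complex.I * deriv (fun s => u s x) t + lapC (u t) x =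
      (‖u t x‖ : ℂ) ^ 2 * u t x - (‖u t x‖ : ℂ) ^ 4 * u t x) ∧
  (∀ J : Set ℝ, IsCompact J → J ⊆ I → ∀ n k : ℕ, ∃ C : ℝ, ∀ t ∈ J, ∀ x : E3,
      (1 + ‖x‖) ^ n * ‖iteratedFDeriv ℝ k (u t) x‖ ≤ C)

section SmoothFunctions

/-- Time-dependent complex functions which are smooth in space at every time. -/
def smoothAlg : Subalgebra ℂ (ℝ → E3 → ℂ) where
  carrier := {f | ∀ t, ContDiff ℝ (⊤ : ℕ∞) (f t)}
  mul_mem' := fun hf hg t => (hf t).mul (hg t)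
  add_mem' := fun hf hg t => (hf t).add (hg t)
  algebraMap_mem' := fun c _ => (contDiff_const : ContDiff ℝ (⊤ : ℕ∞) fun _ : E3 => c)

lemma smoothAlg_differentiable (f : smoothAlg) (t : ℝ) : Differentiable ℝ (f.1 t) :=
  (f.2 t).differentiable (by simp)

lemma contDiff_pdC {f : E3 → ℂ} (hf : ContDiff ℝ (⊤ : ℕ∞) f) (i : Fin 3) :
    ContDiff ℝ (⊤ : ℕ∞) (pdC i f) :=
  (hf.fderiv_right (m := (⊤ : ℕ∞)) (by simp)).clm_apply contDiff_const

lemma pdC_add {f g : E3 → ℂ} (hf : Differentiable ℝ f) (hg : Differentiable ℝ g) (i : Fin 3) :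
    pdC i (f + g) = pdC i f + pdC i g := by
  ext x
  simp [pdC, fderiv_add (hf x) (hg x)]

lemma pdC_mul {f g : E3 → ℂ} (hf : Differentiable ℝ f) (hg : Differentiable ℝ g) (i : Fin 3) :
    pdC i (f * g) = f * pdC i g + g * pdC i f := by
  ext x
  simp [pdC, fderiv_mul (hf x) (hg x)]

lemma pdC_smul {f : E3 → ℂ} (hf : Differentiable ℝ f) (c : ℂ) (i : Fin 3) :
    pdC i (c • f) = c • pdC i f := by
  ext x
  simp [pdC, fderiv_const_smul (hf x) c]

/-- The `i`-th spatial partial derivative, as a derivation. -/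
def pdS (i : Fin 3) : Derivation ℂ smoothAlg smoothAlg :=
  Derivation.mk'
    { toFun := fun f => ⟨fun t => pdC i (f.1 t), fun t => contDiff_pdC (f.2 t) i⟩
      map_add' := fun f g => Subtype.ext <| funext fun t =>
        pdC_add (smoothAlg_differentiable f t) (smoothAlg_differentiable g t) i
      map_smul' := fun c f => Subtype.ext <| funext fun t =>
        pdC_smul (smoothAlg_differentiable f t) c i }
    (fun f g => Subtype.ext <| funext fun t =>
        pdC_mul (smoothAlg_differentiable f t) (smoothAlg_differentiable g t) i)

lemma pdS_apply (i : Fin 3) (f : smoothAlg) (t : ℝ) : (pdS i f).1 t = pdC i (f.1 t) := rfl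

lemma pdS_comm (i j : Fin 3) (f : smoothAlg) : pdS i (pdS j f) = pdS j (pdS i f) := by
  refine Subtype.ext <| funext fun t => funext fun x => ?_
  have hf := f.2 t
  have hsymm : IsSymmSndFDerivAt ℝ (f.1 t) x := hf.contDiffAt.isSymmSndFDerivAt
    (by simpa using WithTop.coe_le_coe.2 (le_top : (2 : ℕ∞) ≤ ⊤))
  have hd : DifferentiableAt ℝ (fderiv ℝ (f.1 t)) x :=
    (hf.fderiv_right (m := (⊤ : ℕ∞)) (by simp)).differentiable (by simp) x
  have key (i j : Fin 3) :
      (pdS i (pdS j f)).1 t x = fderiv ℝ (fderiv ℝ (f.1 t)) x (e3 i) (e3 j) := by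
    change fderiv ℝ (fun y => fderiv ℝ (f.1 t) y (e3 j)) x (e3 i) = _
    rw [fderiv_clm_apply hd (by fun_prop)]
    simp
  rw [key, key]
  exact hsymm _ _

/-- The coordinate functions. -/
def coordS (j : Fin 3) : smoothAlg :=
  ⟨fun _ x => ((x j : ℝ) : ℂ), fun _ =>
    (Complex.ofRealCLM.comp (EuclideanSpace.proj j : E3 →L[ℝ] ℝ)).contDiff⟩

lemma coordS_apply (j : Fin 3) (t : ℝ) (x : E3) : (coordS j).1 t x = ((x j : ℝ) : ℂ) := rfl

lemma pdS_coordS (i j : Fin 3) : pdS i (coordS j) = if i = j then 1 else 0 := by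
  refine Subtype.ext <| funext fun t => funext fun x => ?_
  have h : HasFDerivAt (fun x : E3 => ((x j : ℝ) : ℂ))
      (Complex.ofRealCLM.comp (EuclideanSpace.proj j : E3 →L[ℝ] ℝ)) x :=
    (Complex.ofRealCLM.comp (EuclideanSpace.proj j : E3 →L[ℝ] ℝ)).hasFDerivAt
  change fderiv ℝ (fun x : E3 => ((x j : ℝ) : ℂ)) x (e3 i) = _
  rw [h.fderiv]
  by_cases hij : i = j
  · subst hij; simp [e3]
  · have : ¬ j = i := fun h => hij h.symm
    simp [e3, hij, this]

/-- Pointwise complex conjugation. -/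
def conjS (f : smoothAlg) : smoothAlg :=
  ⟨fun t x => (starRingEnd ℂ) (f.1 t x), fun t =>
    Complex.conjCLE.toContinuousLinearMap.contDiff.comp (f.2 t)⟩

lemma conjS_apply (f : smoothAlg) (t : ℝ) (x : E3) :
    (conjS f).1 t x = (starRingEnd ℂ) (f.1 t x) := rfl

lemma pdS_conjS (i : Fin 3) (f : smoothAlg) : pdS i (conjS f) = conjS (pdS i f) := by
  refine Subtype.ext <| funext fun t => funext fun x => ?_
  have h := Complex.conjCLE.toContinuousLinearMap.hasFDerivAt.comp x
    (smoothAlg_differentiable f t x).hasFDerivAt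
  change fderiv ℝ (fun x => (starRingEnd ℂ) (f.1 t x)) x (e3 i) = _
  have h2 : HasFDerivAt (fun x => (starRingEnd ℂ) (f.1 t x)) _ x := h
  rw [h2.fderiv]
  rfl

end SmoothFunctions

section Decay

/-- Rapid decay in space, locally uniformly in time. -/
def Decays (f : smoothAlg) : Prop :=
  ∀ (T : ℝ) (n : ℕ), ∃ C : ℝ, ∀ t ≤ T, ∀ x : E3, (1 + ‖x‖) ^ n * ‖f.1 t x‖ ≤ C

lemma Decays.add {f g : smoothAlg} (hf : Decays f) (hg : Decays g) : Decays (f + g) := by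
  intro T n
  obtain ⟨C, hC⟩ := hf T n
  obtain ⟨C', hC'⟩ := hg T n
  refine ⟨C + C', fun t ht x => ?_⟩
  calc (1 + ‖x‖) ^ n * ‖f.1 t x + g.1 t x‖
      ≤ (1 + ‖x‖) ^ n * (‖f.1 t x‖ + ‖g.1 t x‖) := by gcongr; exact norm_add_le _ _
    _ ≤ C + C' := by rw [mul_add]; exact add_le_add (hC t ht x) (hC' t ht x)

lemma Decays.mul {f g : smoothAlg} (hf : Decays f) (hg : Decays g) : Decays (f * g) := by
  intro T n
  obtain ⟨C, hC⟩ := hf T n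
  obtain ⟨C', hC'⟩ := hg T 0
  refine ⟨C * C', fun t ht x => ?_⟩
  have h1 := hC t ht x
  have h2 : ‖g.1 t x‖ ≤ C' := by simpa using hC' t ht x
  calc (1 + ‖x‖) ^ n * ‖f.1 t x * g.1 t x‖
      = ((1 + ‖x‖) ^ n * ‖f.1 t x‖) * ‖g.1 t x‖ := by rw [norm_mul]; ring
    _ ≤ C * C' := mul_le_mul h1 h2 (norm_nonneg _) (le_trans (by positivity) h1)

lemma Decays.smul {f : smoothAlg} (hf : Decays f) (c : ℂ) : Decays (c • f) := by
  intro T n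
  obtain ⟨C, hC⟩ := hf T n
  refine ⟨‖c‖ * C, fun t ht x => ?_⟩
  calc (1 + ‖x‖) ^ n * ‖c * f.1 t x‖ = ‖c‖ * ((1 + ‖x‖) ^ n * ‖f.1 t x‖) := by
        rw [norm_mul]; ring
    _ ≤ ‖c‖ * C := mul_le_mul_of_nonneg_left (hC t ht x) (norm_nonneg _)

lemma Decays.coordS_mul {f : smoothAlg} (hf : Decays f) (j : Fin 3) : Decays (coordS j * f) := by
  intro T n
  obtain ⟨C, hC⟩ := hf T (n + 1)
  refine ⟨C, fun t ht x => ?_⟩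
  have hx : ‖((x j : ℝ) : ℂ)‖ ≤ 1 + ‖x‖ := by
    have := PiLp.norm_apply_le x j
    rw [Complex.norm_real]; linarith
  calc (1 + ‖x‖) ^ n * ‖((x j : ℝ) : ℂ) * f.1 t x‖
      ≤ (1 + ‖x‖) ^ n * ((1 + ‖x‖) * ‖f.1 t x‖) := by rw [norm_mul]; gcongr
    _ = (1 + ‖x‖) ^ (n + 1) * ‖f.1 t x‖ := by ring
    _ ≤ C := hC t ht x

lemma Decays.conjS {f : smoothAlg} (hf : Decays f) : Decays (conjS f) := by
  intro T n
  obtain ⟨C, hC⟩ := hf T n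
  exact ⟨C, fun t ht x => by rw [conjS_apply, RCLike.norm_conj]; exact hC t ht x⟩

/-- Rapid decay of all spatial derivatives of order at most `n`. -/
def DecaysUpTo : ℕ → smoothAlg → Prop
  | 0, f => Decays f
  | n + 1, f => Decays f ∧ ∀ i, DecaysUpTo n (pdS i f)

/-- Rapid decay of all spatial derivatives, locally uniformly in time. -/
def IsSchwartz (f : smoothAlg) : Prop := ∀ n, DecaysUpTo n f

lemma IsSchwartz.decays {f : smoothAlg} (hf : IsSchwartz f) : Decays f := hf 0

lemma IsSchwartz.pdS {f : smoothAlg} (hf : IsSchwartz f) (i : Fin 3) : IsSchwartz (pdS i f) :=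
  fun n => (hf (n + 1)).2 i

lemma DecaysUpTo.add {n : ℕ} : ∀ {f g : smoothAlg}, DecaysUpTo n f → DecaysUpTo n g →
    DecaysUpTo n (f + g) := by
  induction n with
  | zero => exact fun hf hg => Decays.add hf hg
  | succ n ih => exact fun hf hg => ⟨hf.1.add hg.1, fun i => by
      rw [map_add]; exact ih (hf.2 i) (hg.2 i)⟩

lemma DecaysUpTo.smul {n : ℕ} (c : ℂ) : ∀ {f : smoothAlg}, DecaysUpTo n f →
    DecaysUpTo n (c • f) := by
  induction n with
  | zero => exact fun hf => Decays.smul hf c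
  | succ n ih => exact fun hf => ⟨hf.1.smul c, fun i => by
      rw [Derivation.map_smul]; exact ih (hf.2 i)⟩

lemma DecaysUpTo.mul {n : ℕ} : ∀ {f g : smoothAlg}, IsSchwartz f → IsSchwartz g →
    DecaysUpTo n (f * g) := by
  induction n with
  | zero => exact fun hf hg => Decays.mul hf.decays hg.decays
  | succ n ih => exact fun hf hg => ⟨hf.decays.mul hg.decays, fun i => by
      rw [Derivation.leibniz]; exact (ih hf (hg.pdS i)).add (ih hg (hf.pdS i))⟩

lemma DecaysUpTo.conjS {n : ℕ} : ∀ {f : smoothAlg}, DecaysUpTo n f →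
    DecaysUpTo n (conjS f) := by
  induction n with
  | zero => exact fun hf => Decays.conjS hf
  | succ n ih => exact fun hf => ⟨hf.1.conjS, fun i => by
      rw [pdS_conjS]; exact ih (hf.2 i)⟩

lemma DecaysUpTo.coordS_mul (j : Fin 3) {n : ℕ} : ∀ {f : smoothAlg}, IsSchwartz f →
    DecaysUpTo n (coordS j * f) := by
  induction n with
  | zero => exact fun hf => Decays.coordS_mul hf.decays j
  | succ n ih =>
    refine fun {f} hf => ⟨hf.decays.coordS_mul j, fun i => ?_⟩
    rw [Derivation.leibniz, pdS_coordS]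
    refine (ih (hf.pdS i)).add ?_
    split_ifs
    · simpa using hf n
    · simpa using (hf n).smul 0

lemma IsSchwartz.add {f g : smoothAlg} (hf : IsSchwartz f) (hg : IsSchwartz g) :
    IsSchwartz (f + g) := fun n => (hf n).add (hg n)

lemma IsSchwartz.smul {f : smoothAlg} (hf : IsSchwartz f) (c : ℂ) :
    IsSchwartz (c • f) := fun n => (hf n).smul c

lemma IsSchwartz.neg {f : smoothAlg} (hf : IsSchwartz f) : IsSchwartz (-f) := by
  simpa using hf.smul (-1)

lemma IsSchwartz.sub {f g : smoothAlg} (hf : IsSchwartz f) (hg : IsSchwartz g) :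
    IsSchwartz (f - g) := by
  rw [sub_eq_add_neg]; exact hf.add hg.neg

lemma IsSchwartz.mul {f g : smoothAlg} (hf : IsSchwartz f) (hg : IsSchwartz g) :
    IsSchwartz (f * g) := fun _ => DecaysUpTo.mul hf hg

lemma IsSchwartz.conjS {f : smoothAlg} (hf : IsSchwartz f) :
    IsSchwartz (conjS f) := fun n => (hf n).conjS

lemma IsSchwartz.coordS_mul {f : smoothAlg} (hf : IsSchwartz f) (j : Fin 3) :
    IsSchwartz (coordS j * f) := fun _ => DecaysUpTo.coordS_mul j hf

lemma IsSchwartz.sum {ι : Type*} {s : Finset ι} {f : ι → smoothAlg}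
    (hf : ∀ i ∈ s, IsSchwartz (f i)) (hs : s.Nonempty) : IsSchwartz (∑ i ∈ s, f i) :=
  Finset.sum_induction_nonempty f IsSchwartz (fun _ _ => IsSchwartz.add) hs hf

lemma isSchwartz_of_iteratedFDeriv {f : smoothAlg}
    (hf : ∀ (T : ℝ) (n k : ℕ), ∃ C : ℝ, ∀ t ≤ T, ∀ x : E3,
      (1 + ‖x‖) ^ n * ‖iteratedFDeriv ℝ k (f.1 t) x‖ ≤ C) : IsSchwartz f := by
  intro m
  induction m generalizing f with
  | zero =>
    intro T n
    obtain ⟨C, hC⟩ := hf T n 0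
    exact ⟨C, fun t ht x => by simpa using hC t ht x⟩
  | succ m ih =>
    refine ⟨fun T n => ?_, fun i => ih fun T n k => ?_⟩
    · obtain ⟨C, hC⟩ := hf T n 0
      exact ⟨C, fun t ht x => by simpa using hC t ht x⟩
    · obtain ⟨C, hC⟩ := hf T n (k + 1)
      refine ⟨C, fun t ht x => le_trans ?_ (hC t ht x)⟩
      gcongr
      have h := norm_iteratedFDeriv_clm_apply_const (𝕜 := ℝ) (f := fderiv ℝ (f.1 t)) (c := e3 i)
        (x := x) (n := k) (N := (⊤ : ℕ∞))
        ((f.2 t).fderiv_right (m := (⊤ : ℕ∞)) (by simp)).contDiffAt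
        (by exact_mod_cast le_top)
      rw [norm_iteratedFDeriv_fderiv] at h
      rw [e3, PiLp.norm_single, norm_one, one_mul] at h
      exact h

end Decay

section Integrals

lemma Decays.exists_bound {f : smoothAlg} (hf : Decays f) (T : ℝ) :
    ∃ C : ℝ, ∀ t ≤ T, ∀ x : E3, ‖f.1 t x‖ ≤ C * (1 + ‖x‖) ^ (-4 : ℝ) := by
  obtain ⟨C, hC⟩ := hf T 4
  refine ⟨C, fun t ht x => ?_⟩
  have hp : 0 < 1 + ‖x‖ := by positivity
  have : (1 + ‖x‖) ^ (-4 : ℝ) = ((1 + ‖x‖) ^ 4)⁻¹ := by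
    rw [Real.rpow_neg hp.le]; norm_cast
  rw [this, ← div_eq_mul_inv, le_div_iff₀ (by positivity), mul_comm]
  exact hC t ht x

lemma integrable_bound (C : ℝ) : Integrable fun x : E3 => C * (1 + ‖x‖) ^ (-4 : ℝ) :=
  (integrable_one_add_norm (by simp; norm_num)).const_mul C

lemma Decays.integrable {f : smoothAlg} (hf : Decays f) (t : ℝ) : Integrable (f.1 t) := by
  obtain ⟨C, hC⟩ := hf.exists_bound t
  exact (integrable_bound C).mono' (f.2 t).continuous.aestronglyMeasurable
    (ae_of_all _ (hC t le_rfl))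

lemma IsSchwartz.integrable {f : smoothAlg} (hf : IsSchwartz f) (t : ℝ) : Integrable (f.1 t) :=
  hf.decays.integrable t

/-- Spatial integral of a time-dependent function. -/
def intS (f : smoothAlg) (t : ℝ) : ℂ := ∫ x, f.1 t x

lemma intS_add {f g : smoothAlg} (hf : IsSchwartz f) (hg : IsSchwartz g) (t : ℝ) :
    intS (f + g) t = intS f t + intS g t :=
  integral_add (hf.integrable t) (hg.integrable t)

lemma intS_smul (f : smoothAlg) (c : ℂ) (t : ℝ) : intS (c • f) t = c * intS f t :=
  integral_const_mul c _

lemma intS_pdS {f : smoothAlg} (hf : IsSchwartz f) (i : Fin 3) (t : ℝ) :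
    intS (pdS i f) t = 0 := by
  have h := integral_mul_fderiv_eq_neg_fderiv_mul_of_integrable (μ := (volume : Measure E3))
    (f := fun _ : E3 => (1 : ℂ)) (g := f.1 t) (v := e3 i) (by simp)
    (by simp only [one_mul]; exact (hf.pdS i).integrable t) (by simpa using hf.integrable t) (by simp)
    (fun x _ => smoothAlg_differentiable f t x)
  simp only [one_mul, fderiv_fun_const, Pi.zero_apply, zero_apply,
    zero_mul, integral_zero, neg_zero] at h
  exact h

lemma intS_div {f : Fin 3 → smoothAlg} (hf : ∀ i, IsSchwartz (f i)) (t : ℝ) :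
    intS (∑ i, pdS i (f i)) t = 0 := by
  rw [Fin.sum_univ_three, intS_add, intS_add, intS_pdS (hf _), intS_pdS (hf _), intS_pdS (hf _)]
  · simp
  all_goals first | exact (hf _).pdS _ | exact ((hf _).pdS _).add ((hf _).pdS _)

lemma continuous_intS {f : smoothAlg} (hf : Decays f)
    (hc : ∀ x, Continuous fun t => f.1 t x) : Continuous (intS f) := by
  refine continuous_iff_continuousAt.2 fun t₀ => ?_
  obtain ⟨C, hC⟩ := hf.exists_bound (t₀ + 1)
  refine continuousAt_of_dominated (bound := fun x => C * (1 + ‖x‖) ^ (-4 : ℝ))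
    (Filter.Eventually.of_forall fun t => (f.2 t).continuous.aestronglyMeasurable) ?_
    (integrable_bound C) (ae_of_all _ fun x => (hc x).continuousAt)
  filter_upwards [Iic_mem_nhds (show t₀ < t₀ + 1 by linarith)] with t ht
  exact ae_of_all _ (hC t ht)

/-- `g` is the pointwise time derivative of `f` at positive times. -/
def HasTimeDeriv (f g : smoothAlg) : Prop :=
  ∀ t > 0, ∀ x, HasDerivAt (fun s => f.1 s x) (g.1 t x) t

lemma HasTimeDeriv.add {f g f' g' : smoothAlg} (hf : HasTimeDeriv f f') (hg : HasTimeDeriv g g') :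
    HasTimeDeriv (f + g) (f' + g') := fun t ht x => (hf t ht x).add (hg t ht x)

lemma HasTimeDeriv.mul {f g f' g' : smoothAlg} (hf : HasTimeDeriv f f') (hg : HasTimeDeriv g g') :
    HasTimeDeriv (f * g) (f' * g + f * g') := fun t ht x => (hf t ht x).mul (hg t ht x)

lemma HasTimeDeriv.smul {f f' : smoothAlg} (hf : HasTimeDeriv f f') (c : ℂ) :
    HasTimeDeriv (c • f) (c • f') := fun t ht x => (hf t ht x).const_mul c

lemma HasTimeDeriv.conjS {f f' : smoothAlg} (hf : HasTimeDeriv f f') :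
    HasTimeDeriv (conjS f) (conjS f') := fun t ht x =>
  Complex.conjCLE.toContinuousLinearMap.hasFDerivAt.comp_hasDerivAt t (hf t ht x)

lemma HasTimeDeriv.intS {f g : smoothAlg} (h : HasTimeDeriv f g) (hf : Decays f) (hg : Decays g)
    {t : ℝ} (ht : 0 < t) : HasDerivAt (intS f) (intS g t) t := by
  obtain ⟨C, hC⟩ := hg.exists_bound (t + 1)
  refine (hasDerivAt_integral_of_dominated_loc_of_deriv_le (F := f.1) (F' := g.1)
    (s := Set.Ioo 0 (t + 1)) (Ioo_mem_nhds ht (by linarith))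
    (Filter.Eventually.of_forall fun s => (f.2 s).continuous.aestronglyMeasurable)
    (hf.integrable t) (g.2 t).continuous.aestronglyMeasurable
    (bound := fun x => C * (1 + ‖x‖) ^ (-4 : ℝ)) (ae_of_all _ fun x s hs => hC s hs.2.le x)
    (integrable_bound C) (ae_of_all _ fun x s hs => h s hs.1 x)).2

end Integrals

section ConservationLaws

/-- The Laplacian on smooth functions. -/
def lapS (f : smoothAlg) : smoothAlg := ∑ i, pdS i (pdS i f)

/-- The right-hand side `Δu - |u|²u + |u|⁴u`, with `v` standing for the conjugate of `u`. -/
def nlsRHS (u v : smoothAlg) : smoothAlg := lapS u - u * u * v + u * u * u * v * v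

/-- A Schwartz solution of the cubic–quintic NLS, together with its complex conjugate. -/
structure IsNLSPair (u v : smoothAlg) : Prop where
  schwartz_left : IsSchwartz u
  schwartz_right : IsSchwartz v
  deriv_left : HasTimeDeriv u (Complex.I • nlsRHS u v)
  deriv_right : HasTimeDeriv v (-Complex.I • nlsRHS v u)
  deriv_pd_left : ∀ i, HasTimeDeriv (pdS i u) (Complex.I • pdS i (nlsRHS u v))
  deriv_pd_right : ∀ i, HasTimeDeriv (pdS i v) (-Complex.I • pdS i (nlsRHS v u))

/-- The kinetic density `∇u ⬝ ∇v`. -/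
def kinetic (u v : smoothAlg) : smoothAlg := ∑ i, pdS i u * pdS i v

/-- The energy density of the cubic–quintic NLS. -/
def energyDensity (u v : smoothAlg) : smoothAlg :=
  (1 / 2 : ℂ) • kinetic u v - (1 / 6 : ℂ) • (u * v * (u * v) * (u * v)) +
    (1 / 4 : ℂ) • (u * v * (u * v))

/-- The variance density `|x|² u v`. -/
def varianceDensity (u v : smoothAlg) : smoothAlg := ∑ j, coordS j * (coordS j * (u * v))

/-- The momentum density, `x ⬝ (v ∇u - u ∇v)` up to a constant factor. -/
def momentumDensity (u v : smoothAlg) : smoothAlg :=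
  (-2 * Complex.I) • ∑ j, coordS j * (v * pdS j u - u * pdS j v)

/-- The density of the second derivative of the variance. -/
def virialDensity (u v : smoothAlg) : smoothAlg :=
  (8 : ℂ) • kinetic u v + (6 : ℂ) • (u * v * (u * v)) - (8 : ℂ) • (u * v * (u * v) * (u * v))

lemma sum_fin3_schwartz {f : Fin 3 → smoothAlg} (hf : ∀ i, IsSchwartz (f i)) :
    IsSchwartz (∑ i, f i) := IsSchwartz.sum (fun i _ => hf i) Finset.univ_nonempty

lemma IsSchwartz.nlsRHS {u v : smoothAlg} (hu : IsSchwartz u) (hv : IsSchwartz v) :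
    IsSchwartz (nlsRHS u v) :=
  ((sum_fin3_schwartz fun i => (hu.pdS i).pdS i).sub ((hu.mul hu).mul hv)).add
    ((((hu.mul hu).mul hu).mul hv).mul hv)

lemma IsSchwartz.kinetic {u v : smoothAlg} (hu : IsSchwartz u) (hv : IsSchwartz v) :
    IsSchwartz (kinetic u v) := sum_fin3_schwartz fun i => (hu.pdS i).mul (hv.pdS i)

lemma IsSchwartz.quartic {u v : smoothAlg} (hu : IsSchwartz u) (hv : IsSchwartz v) :
    IsSchwartz (u * v * (u * v)) := (hu.mul hv).mul (hu.mul hv)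

lemma IsSchwartz.sextic {u v : smoothAlg} (hu : IsSchwartz u) (hv : IsSchwartz v) :
    IsSchwartz (u * v * (u * v) * (u * v)) := (hu.quartic hv).mul (hu.mul hv)

lemma IsSchwartz.energyDensity {u v : smoothAlg} (hu : IsSchwartz u) (hv : IsSchwartz v) :
    IsSchwartz (energyDensity u v) :=
  (((hu.kinetic hv).smul _).sub ((hu.sextic hv).smul _)).add ((hu.quartic hv).smul _)

lemma IsSchwartz.varianceDensity {u v : smoothAlg} (hu : IsSchwartz u) (hv : IsSchwartz v) :
    IsSchwartz (varianceDensity u v) :=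
  sum_fin3_schwartz fun j => ((hu.mul hv).coordS_mul j).coordS_mul j

lemma IsSchwartz.momentumDensity {u v : smoothAlg} (hu : IsSchwartz u) (hv : IsSchwartz v) :
    IsSchwartz (momentumDensity u v) :=
  (sum_fin3_schwartz fun j =>
    ((hv.mul (hu.pdS j)).sub (hu.mul (hv.pdS j))).coordS_mul j).smul _

lemma IsSchwartz.virialDensity {u v : smoothAlg} (hu : IsSchwartz u) (hv : IsSchwartz v) :
    IsSchwartz (virialDensity u v) :=
  (((hu.kinetic hv).smul _).add ((hu.quartic hv).smul _)).sub ((hu.sextic hv).smul _)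

lemma HasTimeDeriv.sum_fin3 {f g : Fin 3 → smoothAlg} (h : ∀ i, HasTimeDeriv (f i) (g i)) :
    HasTimeDeriv (∑ i, f i) (∑ i, g i) := by
  simp only [Fin.sum_univ_three]
  exact ((h 0).add (h 1)).add (h 2)

lemma HasTimeDeriv.sub {f g f' g' : smoothAlg} (hf : HasTimeDeriv f f') (hg : HasTimeDeriv g g') :
    HasTimeDeriv (f - g) (f' - g') := fun t ht x => (hf t ht x).sub (hg t ht x)

lemma HasTimeDeriv.coordS_mul {f f' : smoothAlg} (hf : HasTimeDeriv f f') (j : Fin 3) :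
    HasTimeDeriv (coordS j * f) (coordS j * f') := fun t ht x => (hf t ht x).const_mul _

lemma coe_add_apply (f g : smoothAlg) (t : ℝ) (x : E3) : (f + g).1 t x = f.1 t x + g.1 t x := rfl
lemma coe_sub_apply (f g : smoothAlg) (t : ℝ) (x : E3) : (f - g).1 t x = f.1 t x - g.1 t x := rfl
lemma coe_mul_apply (f g : smoothAlg) (t : ℝ) (x : E3) : (f * g).1 t x = f.1 t x * g.1 t x := rfl
lemma coe_smul_apply (c : ℂ) (f : smoothAlg) (t : ℝ) (x : E3) :
    (c • f).1 t x = c * f.1 t x := rfl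
lemma coe_zero_apply (t : ℝ) (x : E3) : (0 : smoothAlg).1 t x = 0 := rfl
lemma coe_one_apply (t : ℝ) (x : E3) : (1 : smoothAlg).1 t x = 1 := rfl

lemma mass_identity (u v : smoothAlg) :
    (Complex.I • nlsRHS u v) * v + u * (-Complex.I • nlsRHS v u) =
      ∑ i, pdS i (Complex.I • (v * pdS i u - u * pdS i v)) := by
  refine Subtype.ext <| funext fun t => funext fun x => ?_
  simp only [nlsRHS, lapS, Fin.sum_univ_three, Derivation.map_smul, Derivation.map_sub,
    Derivation.leibniz, smul_eq_mul, coe_add_apply, coe_sub_apply, coe_mul_apply, coe_smul_apply]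
  ring

lemma variance_identity (u v : smoothAlg) :
    ∑ j, coordS j * (coordS j *
      ((Complex.I • nlsRHS u v) * v + u * (-Complex.I • nlsRHS v u))) =
      ∑ i, pdS i (Complex.I • ∑ j, coordS j * (coordS j * (v * pdS i u - u * pdS i v))) +
        momentumDensity u v := by
  refine Subtype.ext <| funext fun t => funext fun x => ?_
  simp only [nlsRHS, lapS, momentumDensity, Fin.sum_univ_three, Derivation.map_smul,
    Derivation.map_sub, Derivation.map_add, Derivation.leibniz, smul_eq_mul, pdS_coordS,
    Fin.isValue, Fin.reduceEq, if_true, if_false, coe_add_apply, coe_sub_apply, coe_mul_apply,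
    coe_smul_apply, coe_zero_apply, coe_one_apply]
  ring

lemma energy_identity (u v : smoothAlg) :
    (1 / 2 : ℂ) • ∑ i, ((Complex.I • pdS i (nlsRHS u v)) * pdS i v +
        pdS i u * (-Complex.I • pdS i (nlsRHS v u))) -
      (1 / 6 : ℂ) • ((((Complex.I • nlsRHS u v) * v + u * (-Complex.I • nlsRHS v u)) * (u * v) +
        u * v * ((Complex.I • nlsRHS u v) * v + u * (-Complex.I • nlsRHS v u))) * (u * v) +
        u * v * (u * v) * ((Complex.I • nlsRHS u v) * v + u * (-Complex.I • nlsRHS v u))) +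
      (1 / 4 : ℂ) • (((Complex.I • nlsRHS u v) * v + u * (-Complex.I • nlsRHS v u)) * (u * v) +
        u * v * ((Complex.I • nlsRHS u v) * v + u * (-Complex.I • nlsRHS v u))) =
      ∑ i, pdS i ((Complex.I / 2) • (nlsRHS u v * pdS i v - nlsRHS v u * pdS i u)) := by
  refine Subtype.ext <| funext fun t => funext fun x => ?_
  have hF : nlsRHS u v = lapS u - u * u * v + u * u * u * v * v := rfl
  have hG : nlsRHS v u = lapS v - v * v * u + v * v * v * u * u := rfl
  simp only [Fin.sum_univ_three, Derivation.map_smul,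
    Derivation.map_sub, Derivation.leibniz, smul_eq_mul,
    coe_add_apply, coe_sub_apply, coe_mul_apply, coe_smul_apply]
  generalize (pdS 0 (nlsRHS u v)).1 t x = a0
  generalize (pdS 1 (nlsRHS u v)).1 t x = a1
  generalize (pdS 2 (nlsRHS u v)).1 t x = a2
  generalize (pdS 0 (nlsRHS v u)).1 t x = b0
  generalize (pdS 1 (nlsRHS v u)).1 t x = b1
  generalize (pdS 2 (nlsRHS v u)).1 t x = b2
  simp only [hF, hG, lapS, Fin.sum_univ_three, coe_add_apply, coe_sub_apply, coe_mul_apply]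
  ring

lemma virial_identity (u v : smoothAlg) :
    (-2 * Complex.I) • ∑ j, coordS j *
      (((-Complex.I • nlsRHS v u) * pdS j u + v * (Complex.I • pdS j (nlsRHS u v))) -
        ((Complex.I • nlsRHS u v) * pdS j v + u * (-Complex.I • pdS j (nlsRHS v u)))) =
      ∑ i, pdS i ((2 : ℂ) • (coordS i * (v * nlsRHS u v + u * nlsRHS v u)) -
        (4 : ℂ) • (∑ j, coordS j * (pdS i v * pdS j u + pdS i u * pdS j v) -
          coordS i * kinetic u v) -
        (4 : ℂ) • (coordS i * ((1 / 3 : ℂ) • (u * v * (u * v) * (u * v)) -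
          (1 / 2 : ℂ) • (u * v * (u * v)))) -
        (6 : ℂ) • (v * pdS i u + u * pdS i v)) + virialDensity u v := by
  refine Subtype.ext <| funext fun t => funext fun x => ?_
  have hF : nlsRHS u v = lapS u - u * u * v + u * u * u * v * v := rfl
  have hG : nlsRHS v u = lapS v - v * v * u + v * v * v * u * u := rfl
  have hI : Complex.I ^ 2 = -1 := Complex.I_sq
  simp only [kinetic, virialDensity, Fin.sum_univ_three, Derivation.map_smul,
    Derivation.map_sub, Derivation.map_add, Derivation.leibniz, smul_eq_mul, pdS_coordS,
    Fin.isValue, Fin.reduceEq, if_true, if_false, pdS_comm 1 0, pdS_comm 2 0, pdS_comm 2 1,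
    coe_add_apply, coe_sub_apply, coe_mul_apply, coe_smul_apply, coe_zero_apply, coe_one_apply]
  generalize (pdS 0 (nlsRHS u v)).1 t x = a0
  generalize (pdS 1 (nlsRHS u v)).1 t x = a1
  generalize (pdS 2 (nlsRHS u v)).1 t x = a2
  generalize (pdS 0 (nlsRHS v u)).1 t x = b0
  generalize (pdS 1 (nlsRHS v u)).1 t x = b1
  generalize (pdS 2 (nlsRHS v u)).1 t x = b2
  simp only [hF, hG, lapS, Fin.sum_univ_three, coe_add_apply, coe_sub_apply, coe_mul_apply]
  ring_nf
  simp only [hI]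
  ring

namespace IsNLSPair

variable {u v : smoothAlg}

lemma deriv_mul (h : IsNLSPair u v) : HasTimeDeriv (u * v)
    ((Complex.I • nlsRHS u v) * v + u * (-Complex.I • nlsRHS v u)) :=
  h.deriv_left.mul h.deriv_right

lemma schwartz_F (h : IsNLSPair u v) : IsSchwartz (nlsRHS u v) :=
  h.schwartz_left.nlsRHS h.schwartz_right

lemma schwartz_G (h : IsNLSPair u v) : IsSchwartz (nlsRHS v u) :=
  h.schwartz_right.nlsRHS h.schwartz_left

lemma schwartz_current (h : IsNLSPair u v) (i : Fin 3) :
    IsSchwartz (v * pdS i u - u * pdS i v) :=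
  (h.schwartz_right.mul (h.schwartz_left.pdS i)).sub
    (h.schwartz_left.mul (h.schwartz_right.pdS i))

lemma schwartz_deriv_mul (h : IsNLSPair u v) :
    IsSchwartz ((Complex.I • nlsRHS u v) * v + u * (-Complex.I • nlsRHS v u)) :=
  ((h.schwartz_F.smul _).mul h.schwartz_right).add (h.schwartz_left.mul (h.schwartz_G.smul _))

lemma mass_hasDerivAt (h : IsNLSPair u v) {t : ℝ} (ht : 0 < t) :
    HasDerivAt (intS (u * v)) 0 t := by
  have := h.deriv_mul.intS (h.schwartz_left.mul h.schwartz_right).decays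
    h.schwartz_deriv_mul.decays ht
  rwa [mass_identity, intS_div fun i => (h.schwartz_current i).smul _] at this

lemma variance_hasDerivAt (h : IsNLSPair u v) {t : ℝ} (ht : 0 < t) :
    HasDerivAt (intS (varianceDensity u v)) (intS (momentumDensity u v) t) t := by
  have hd := HasTimeDeriv.sum_fin3 fun j => (h.deriv_mul.coordS_mul j).coordS_mul j
  have hflux (i : Fin 3) : IsSchwartz
      (Complex.I • ∑ j, coordS j * (coordS j * (v * pdS i u - u * pdS i v))) :=
    (sum_fin3_schwartz fun j => ((h.schwartz_current i).coordS_mul j).coordS_mul j).smul _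
  have := hd.intS (h.schwartz_left.varianceDensity h.schwartz_right).decays
    (sum_fin3_schwartz fun j => (h.schwartz_deriv_mul.coordS_mul j).coordS_mul j).decays ht
  rwa [variance_identity, intS_add (sum_fin3_schwartz fun i => (hflux i).pdS i)
    (h.schwartz_left.momentumDensity h.schwartz_right), intS_div hflux, zero_add] at this

lemma energy_hasDerivAt (h : IsNLSPair u v) {t : ℝ} (ht : 0 < t) :
    HasDerivAt (intS (energyDensity u v)) 0 t := by
  have hq := h.deriv_mul.mul h.deriv_mul
  have hd := (((HasTimeDeriv.sum_fin3 fun i =>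
    (h.deriv_pd_left i).mul (h.deriv_pd_right i)).smul (1 / 2)).sub
    ((hq.mul h.deriv_mul).smul (1 / 6))).add (hq.smul (1 / 4))
  have hflux (i : Fin 3) : IsSchwartz
      ((Complex.I / 2) • (nlsRHS u v * pdS i v - nlsRHS v u * pdS i u)) :=
    ((h.schwartz_F.mul (h.schwartz_right.pdS i)).sub
      (h.schwartz_G.mul (h.schwartz_left.pdS i))).smul _
  rw [energy_identity] at hd
  have := hd.intS (h.schwartz_left.energyDensity h.schwartz_right).decays
    (sum_fin3_schwartz fun i => (hflux i).pdS i).decays ht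
  rwa [intS_div hflux] at this

lemma momentum_hasDerivAt (h : IsNLSPair u v) {t : ℝ} (ht : 0 < t) :
    HasDerivAt (intS (momentumDensity u v)) (intS (virialDensity u v) t) t := by
  have hu := h.schwartz_left
  have hv := h.schwartz_right
  have hd := (HasTimeDeriv.sum_fin3 fun j =>
    (((h.deriv_right.mul (h.deriv_pd_left j)).sub
      (h.deriv_left.mul (h.deriv_pd_right j))).coordS_mul j)).smul (-2 * Complex.I)
  rw [virial_identity] at hd
  have hflux (i : Fin 3) : IsSchwartz
      ((2 : ℂ) • (coordS i * (v * nlsRHS u v + u * nlsRHS v u)) -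
        (4 : ℂ) • (∑ j, coordS j * (pdS i v * pdS j u + pdS i u * pdS j v) -
          coordS i * kinetic u v) -
        (4 : ℂ) • (coordS i * ((1 / 3 : ℂ) • (u * v * (u * v) * (u * v)) -
          (1 / 2 : ℂ) • (u * v * (u * v)))) -
        (6 : ℂ) • (v * pdS i u + u * pdS i v)) := by
    refine ((((((hv.mul h.schwartz_F).add (hu.mul h.schwartz_G)).coordS_mul i).smul _).sub
      (IsSchwartz.smul (IsSchwartz.sub (sum_fin3_schwartz fun j => ?_)
        ((hu.kinetic hv).coordS_mul i)) _)).sub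
      (((((hu.sextic hv).smul _).sub ((hu.quartic hv).smul _)).coordS_mul i).smul _)).sub
      (((hv.mul (hu.pdS i)).add (hu.mul (hv.pdS i))).smul _)
    exact (((hv.pdS i).mul (hu.pdS j)).add ((hu.pdS i).mul (hv.pdS j))).coordS_mul j
  have hdiv := sum_fin3_schwartz fun i => (hflux i).pdS i
  have hvir := hu.virialDensity hv
  have := hd.intS (hu.momentumDensity hv).decays (hdiv.add hvir).decays ht
  rwa [intS_add hdiv hvir, intS_div hflux, zero_add] at this

end IsNLSPair

end ConservationLaws

section Bliss

open Filter Topology Set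

/-- The radial kinetic energy `∫ r² (dW/dr)² dr` of the Aubin–Talenti ground state. -/
def blissConst : ℝ := 3 * √3 * Real.pi / 16

lemma blissConst_pos : 0 < blissConst := by unfold blissConst; positivity

lemma blissConst_sq : blissConst ^ 2 = 27 * Real.pi ^ 2 / 256 := by
  unfold blissConst
  have : √3 ^ 2 = 3 := Real.sq_sqrt (by norm_num)
  linear_combination (9 * Real.pi ^ 2 / 256) * this

lemma inner_pointwise_bound {a z : ℂ} {r M σ : ℝ} (hσ : σ ^ 2 = 1) (hr : 0 ≤ r) (hM : 0 < M)
    (hq : r * ‖a‖ ^ 2 ≤ M) :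
    1 / 2 * (σ * √(1 - (r * ‖a‖ ^ 2 / M) ^ 2) * (‖a‖ ^ 2 + r * (2 * inner ℝ a z)) -
        (‖a‖ ^ 2 + r * (2 * inner ℝ a z))) ≤
      r ^ 2 * ‖z‖ ^ 2 - r ^ 2 * ‖a‖ ^ 6 / (4 * M ^ 2) := by
  set s := √(1 - (r * ‖a‖ ^ 2 / M) ^ 2) with hs
  have hs0 : 0 ≤ s := Real.sqrt_nonneg _
  have hs2 : s ^ 2 = 1 - (r * ‖a‖ ^ 2 / M) ^ 2 := by
    refine Real.sq_sqrt ?_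
    have h1 : r * ‖a‖ ^ 2 / M ≤ 1 := (div_le_one hM).2 hq
    have h0 : 0 ≤ r * ‖a‖ ^ 2 / M := by positivity
    nlinarith
  set w : ℂ := (1 / 2 : ℝ) • a + r • z with hw
  have haw : inner ℝ a w = 1 / 2 * ‖a‖ ^ 2 + r * inner ℝ a z := by
    rw [hw, inner_add_right, inner_smul_right, inner_smul_right, real_inner_self_eq_norm_sq]
  have hww : ‖w‖ ^ 2 = 1 / 4 * ‖a‖ ^ 2 + r * inner ℝ a z + r ^ 2 * ‖z‖ ^ 2 := by
    rw [hw, norm_add_sq_real, norm_smul, norm_smul, inner_smul_left, inner_smul_right]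
    simp only [Real.norm_eq_abs, mul_pow, sq_abs, conj_trivial]
    ring
  have hle : σ * inner ℝ a w ≤ ‖a‖ * ‖w‖ := by
    have h1 := abs_real_inner_le_norm a w
    have h2 : |σ| = 1 := by rw [← sq_eq_sq₀ (abs_nonneg _) zero_le_one, sq_abs, hσ, one_pow]
    calc σ * inner ℝ a w ≤ |σ * inner ℝ a w| := le_abs_self _
      _ = |inner ℝ a w| := by rw [abs_mul, h2, one_mul]
      _ ≤ _ := h1
  have hmain : s * (σ * inner ℝ a w) ≤ ‖w‖ ^ 2 + 1 / 4 * ‖a‖ ^ 2 * s ^ 2 := by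
    nlinarith [mul_le_mul_of_nonneg_left hle hs0, sq_nonneg (‖w‖ - 1 / 2 * (‖a‖ * s))]
  have hsix : r ^ 2 * ‖a‖ ^ 6 / (4 * M ^ 2) = 1 / 4 * ‖a‖ ^ 2 * (1 - s ^ 2) := by
    rw [hs2]; field_simp; ring
  rw [hsix]
  rw [haw, hww] at hmain
  nlinarith

/-- Primitive of `√(1 - (y / M)²)`. -/
def sqrtPrimitive (M z : ℝ) : ℝ := ∫ y in (0 : ℝ)..z, √(1 - (y / M) ^ 2)

lemma hasDerivAt_sqrtPrimitive (M z : ℝ) :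
    HasDerivAt (sqrtPrimitive M) √(1 - (z / M) ^ 2) z :=
  ((by fun_prop : Continuous fun y : ℝ => √(1 - (y / M) ^ 2)).integral_hasStrictDerivAt
    0 z).hasDerivAt

lemma sqrtPrimitive_zero (M : ℝ) : sqrtPrimitive M 0 = 0 := by simp [sqrtPrimitive]

lemma integral_sqrt_one_sub_sq_half : ∫ y in (0 : ℝ)..1, √(1 - y ^ 2) = Real.pi / 4 := by
  have hc : Continuous fun y : ℝ => √(1 - y ^ 2) := by fun_prop
  have h1 := intervalIntegral.integral_add_adjacent_intervals (a := -1) (b := 0) (c := 1)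
    (hc.intervalIntegrable _ _) (hc.intervalIntegrable _ _) (μ := volume)
  have h2 : ∫ y in (-1 : ℝ)..0, √(1 - y ^ 2) = ∫ y in (0 : ℝ)..1, √(1 - y ^ 2) := by
    have := intervalIntegral.integral_comp_neg (a := 0) (b := 1) fun y : ℝ => √(1 - y ^ 2)
    simpa using this.symm
  rw [h2, integral_sqrt_one_sub_sq] at h1
  linarith

lemma sqrtPrimitive_self {M : ℝ} (hM : 0 < M) : sqrtPrimitive M M = M * Real.pi / 4 := by
  have h := intervalIntegral.integral_comp_div (a := 0) (b := M) (fun y : ℝ => √(1 - y ^ 2)) hM.ne'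
  rw [sqrtPrimitive, h, zero_div, div_self hM.ne', integral_sqrt_one_sub_sq_half, smul_eq_mul]
  ring

/-- The sharp radial Sobolev inequality, in polar coordinates. -/
theorem bliss_inequality {φ φ' : ℝ → ℂ} (hφ : ∀ r, HasDerivAt φ (φ' r) r)
    (hc : Continuous φ') (hdecay : Tendsto (fun r => r * ‖φ r‖ ^ 2) atTop (𝓝 0))
    (hK : IntegrableOn (fun r => r ^ 2 * ‖φ' r‖ ^ 2) (Ioi 0))
    (hP : IntegrableOn (fun r => r ^ 2 * ‖φ r‖ ^ 6) (Ioi 0)) :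
    blissConst ^ 2 * ∫ r in Ioi 0, r ^ 2 * ‖φ r‖ ^ 6 ≤
      (∫ r in Ioi 0, r ^ 2 * ‖φ' r‖ ^ 2) ^ 3 := by
  have hφc : Continuous φ := continuous_iff_continuousAt.2 fun r => (hφ r).continuousAt
  have hA : 0 ≤ ∫ r in Ioi 0, r ^ 2 * ‖φ' r‖ ^ 2 :=
    setIntegral_nonneg measurableSet_Ioi fun r _ => by positivity
  set q : ℝ → ℝ := fun r => r * ‖φ r‖ ^ 2 with hq
  set q' : ℝ → ℝ := fun r => ‖φ r‖ ^ 2 + r * (2 * inner ℝ (φ r) (φ' r)) with hq'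
  have hqc : Continuous q := by fun_prop
  have hqd (r : ℝ) : HasDerivAt q (q' r) r := by
    exact ((hasDerivAt_id r).mul (hφ r).norm_sq).congr_deriv (by simp [hq'])
  by_cases hzero : ∀ r > 0, q r = 0
  · have : ∫ r in Ioi 0, r ^ 2 * ‖φ r‖ ^ 6 = 0 := by
      refine (setIntegral_congr_fun measurableSet_Ioi fun r hr => ?_).trans
        (integral_zero ℝ ℝ)
      have h1 := hzero r hr
      have h2 : ‖φ r‖ ^ 2 = 0 := by
        rcases mul_eq_zero.1 h1 with h | h
        · exact absurd h (ne_of_gt hr)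
        · exact h
      change r ^ 2 * ‖φ r‖ ^ 6 = 0
      rw [pow_eq_zero_iff two_ne_zero |>.1 h2]
      simp
    rw [this, mul_zero]
    positivity
  push Not at hzero
  obtain ⟨r₁, hr₁, hne⟩ := hzero
  have hq1 : 0 < q r₁ := lt_of_le_of_ne (by positivity) hne.symm
  obtain ⟨R₁, hR₁⟩ := eventually_atTop.1 (hdecay.eventually (gt_mem_nhds hq1))
  obtain ⟨r₀, hr₀, hmax⟩ := (isCompact_Icc (a := 0) (b := max R₁ r₁)).exists_isMaxOn
    ⟨0, by simp; right; exact hr₁.le⟩ hqc.continuousOn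
  have hr₁mem : r₁ ∈ Icc 0 (max R₁ r₁) := ⟨hr₁.le, le_max_right _ _⟩
  have hM : 0 < q r₀ := hq1.trans_le (hmax hr₁mem)
  set M := q r₀ with hMdef
  have hqM (r : ℝ) (hr : 0 ≤ r) : q r ≤ M := by
    by_cases h : r ≤ max R₁ r₁
    · exact hmax ⟨hr, h⟩
    · exact (hR₁ r ((le_max_left _ _).trans (not_le.1 h).le)).le.trans (hmax hr₁mem)
  set J : ℝ → ℝ := fun r => r ^ 2 * ‖φ' r‖ ^ 2 - r ^ 2 * ‖φ r‖ ^ 6 / (4 * M ^ 2) with hJ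
  have hJc : Continuous J := by fun_prop
  have hq'c : Continuous q' := by
    have : Continuous fun r => (inner ℝ (φ r) (φ' r) : ℝ) := hφc.inner hc
    fun_prop
  set S : ℝ → ℝ := fun r => √(1 - (q r / M) ^ 2)
  have hSc : Continuous S := by fun_prop
  have hprim (σ r : ℝ) : HasDerivAt (fun r => 1 / 2 * (σ * sqrtPrimitive M (q r) - q r))
      (1 / 2 * (σ * S r * q' r - q' r)) r := by
    have := ((((hasDerivAt_sqrtPrimitive M (q r)).comp r (hqd r)).const_mul σ).sub
      (hqd r)).const_mul (1 / 2)
    simpa [mul_assoc] using this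
  have hstep (σ : ℝ) (hσ : σ ^ 2 = 1) {a b : ℝ} (ha : 0 ≤ a) (hab : a ≤ b) :
      1 / 2 * (σ * sqrtPrimitive M (q b) - q b) - 1 / 2 * (σ * sqrtPrimitive M (q a) - q a) ≤
        ∫ r in a..b, J r := by
    have hcont : Continuous fun r => 1 / 2 * (σ * S r * q' r - q' r) := by fun_prop
    rw [← intervalIntegral.integral_eq_sub_of_hasDerivAt (fun r _ => hprim σ r)
      (hcont.intervalIntegrable _ _)]
    refine intervalIntegral.integral_mono_on hab (hcont.intervalIntegrable _ _)
      (hJc.intervalIntegrable _ _) fun r hr => ?_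
    exact inner_pointwise_bound hσ (ha.trans hr.1) hM (hqM r (ha.trans hr.1))
  have hfin (R : ℝ) (hR : r₀ ≤ R) :
      M * Real.pi / 4 - 1 / 2 * (sqrtPrimitive M (q R) + q R) ≤ ∫ r in (0 : ℝ)..R, J r := by
    have h1 := hstep 1 (by norm_num) le_rfl hr₀.1
    have h2 := hstep (-1) (by norm_num) hr₀.1 hR
    have hq0 : q 0 = 0 := by simp [hq]
    rw [hq0, sqrtPrimitive_zero, ← hMdef, sqrtPrimitive_self hM] at h1
    rw [← hMdef, sqrtPrimitive_self hM] at h2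
    rw [← intervalIntegral.integral_add_adjacent_intervals (hJc.intervalIntegrable 0 r₀)
      (hJc.intervalIntegrable r₀ R)]
    linarith
  have hPint : IntegrableOn (fun r => r ^ 2 * ‖φ r‖ ^ 6 / (4 * M ^ 2)) (Ioi 0) :=
    hP.div_const _
  have hJint : IntegrableOn J (Ioi 0) := hK.sub hPint
  have hlim1 := intervalIntegral_tendsto_integral_Ioi 0 hJint tendsto_id
  have hlim2 : Tendsto (fun R => M * Real.pi / 4 - 1 / 2 * (sqrtPrimitive M (q R) + q R)) atTop
      (𝓝 (M * Real.pi / 4 - 1 / 2 * (sqrtPrimitive M 0 + 0))) :=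
    tendsto_const_nhds.sub ((((hasDerivAt_sqrtPrimitive M 0).continuousAt.tendsto.comp
      hdecay).add hdecay).const_mul _)
  have hle := le_of_tendsto_of_tendsto hlim2 hlim1 (eventually_atTop.2 ⟨r₀, hfin⟩)
  have hJeq : ∫ r in Ioi 0, J r = (∫ r in Ioi 0, r ^ 2 * ‖φ' r‖ ^ 2) -
      (∫ r in Ioi 0, r ^ 2 * ‖φ r‖ ^ 6) / (4 * M ^ 2) := by
    rw [← integral_div]; exact integral_sub hK hPint
  rw [hJeq, sqrtPrimitive_zero] at hle
  set A := ∫ r in Ioi 0, r ^ 2 * ‖φ' r‖ ^ 2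
  set P := ∫ r in Ioi 0, r ^ 2 * ‖φ r‖ ^ 6
  have hP' : P ≤ 4 * M ^ 2 * (A - M * Real.pi / 4) := by
    have : P / (4 * M ^ 2) ≤ A - M * Real.pi / 4 := by linarith
    rw [div_le_iff₀ (by positivity)] at this
    linarith
  rw [blissConst_sq]
  have hpi := Real.pi_pos
  have hfac : 0 ≤ (8 * A - 3 * (M * Real.pi)) ^ 2 * (4 * A + 3 * (M * Real.pi)) := by positivity
  have := mul_le_mul_of_nonneg_left hP' (by positivity : 0 ≤ 27 * Real.pi ^ 2 / 256)
  nlinarith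

/-- Primitive of the radial kinetic density of the ground state. -/
def groundPrimitive (r : ℝ) : ℝ :=
  √3 * (3 / 8 * Real.arctan (r / √3)) - (5 / 24 * r ^ 3 + 3 / 8 * r) / (1 + r ^ 2 / 3) ^ 2

lemma hasDerivAt_groundPrimitive (r : ℝ) :
    HasDerivAt groundPrimitive (r ^ 2 * (r ^ 2 / 9 * ((1 + r ^ 2 / 3) ^ 3)⁻¹)) r := by
  have h3 : √3 ^ 2 = 3 := Real.sq_sqrt (by norm_num)
  have h3' : √3 ≠ 0 := by positivity
  have hX : HasDerivAt (fun r : ℝ => (1 + r ^ 2 / 3) ^ 2) (2 * (1 + r ^ 2 / 3) * (2 * r / 3)) r := by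
    exact (((((hasDerivAt_id r).pow 2).div_const 3).const_add 1).pow 2).congr_deriv (by simp)
  have hN : HasDerivAt (fun r : ℝ => 5 / 24 * r ^ 3 + 3 / 8 * r) (5 / 8 * r ^ 2 + 3 / 8) r := by
    exact ((((hasDerivAt_id r).pow 3).const_mul (5 / 24)).add
      ((hasDerivAt_id r).const_mul (3 / 8))).congr_deriv (by simp; ring)
  have hA := ((((hasDerivAt_id r).div_const √3).arctan).const_mul (3 / 8)).const_mul √3
  have hpos : (1 + r ^ 2 / 3) ≠ 0 := by positivity
  refine (hA.sub (hN.div hX (pow_ne_zero 2 hpos))).congr_deriv ?_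
  have h4 : 1 + (id r / √3) ^ 2 = 1 + r ^ 2 / 3 := by rw [id, div_pow, h3]
  rw [h4]
  have hpos' : (3 + r ^ 2) ≠ 0 := by positivity
  field_simp
  ring

lemma tendsto_cubic_div : Tendsto (fun r : ℝ => (r ^ 3) / (1 + r ^ 2 / 3) ^ 2) atTop (𝓝 0) := by
  refine squeeze_zero' (g := fun r : ℝ => 9 * r⁻¹) ?_ ?_ ?_
  · filter_upwards [eventually_gt_atTop 0] with r hr using by positivity
  · filter_upwards [eventually_gt_atTop 0] with r hr
    rw [div_le_iff₀ (by positivity)]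
    have : r * r⁻¹ = 1 := mul_inv_cancel₀ hr.ne'
    have h2 : 9 * r⁻¹ * (1 + r ^ 2 / 3) ^ 2 = r ^ 3 * (r * r⁻¹) + 6 * r * (r * r⁻¹) + 9 * r⁻¹ := by
      ring
    rw [h2, this]
    have : 0 < r⁻¹ := by positivity
    linarith
  · simpa using tendsto_inv_atTop_zero.const_mul (9 : ℝ)

lemma tendsto_groundPrimitive : Tendsto groundPrimitive atTop (𝓝 blissConst) := by
  have h1 : Tendsto (fun r : ℝ => Real.arctan (r / √3)) atTop (𝓝 (Real.pi / 2)) :=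
    (Real.tendsto_arctan_atTop.mono_right nhdsWithin_le_nhds).comp
      (tendsto_id.atTop_div_const (by positivity))
  have h2 : Tendsto (fun r : ℝ => (5 / 24 * r ^ 3 + 3 / 8 * r) / (1 + r ^ 2 / 3) ^ 2) atTop
      (𝓝 0) := by
    refine squeeze_zero' (g := fun r : ℝ => r ^ 3 / (1 + r ^ 2 / 3) ^ 2) ?_ ?_ tendsto_cubic_div
    · filter_upwards [eventually_gt_atTop 0] with r hr using by positivity
    · filter_upwards [eventually_gt_atTop 1] with r hr
      gcongr
      nlinarith [sq_nonneg (r - 1), mul_pos (by linarith : 0 < r) (by linarith : 0 < r - 1)]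
  have := ((h1.const_mul (3 / 8)).const_mul √3).sub h2
  have hlim : √3 * (3 / 8 * (Real.pi / 2)) - 0 = blissConst := by unfold blissConst; ring
  rwa [hlim] at this

lemma integrableOn_ground_kinetic :
    IntegrableOn (fun r : ℝ => r ^ 2 * (r ^ 2 / 9 * ((1 + r ^ 2 / 3) ^ 3)⁻¹)) (Ioi 0) :=
  integrableOn_Ioi_deriv_of_nonneg' (fun r _ => hasDerivAt_groundPrimitive r)
    (fun r _ => by positivity) tendsto_groundPrimitive

lemma integral_ground_kinetic :
    ∫ r in Ioi (0 : ℝ), r ^ 2 * (r ^ 2 / 9 * ((1 + r ^ 2 / 3) ^ 3)⁻¹) = blissConst := by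
  rw [integral_Ioi_of_hasDerivAt_of_nonneg' (fun r _ => hasDerivAt_groundPrimitive r)
    (fun r _ => by positivity) tendsto_groundPrimitive]
  simp [groundPrimitive]

lemma hasDerivAt_ground_sextic (r : ℝ) :
    HasDerivAt (fun r => groundPrimitive r + 1 / 3 * (r ^ 3 / (1 + r ^ 2 / 3) ^ 2))
      (r ^ 2 * ((1 + r ^ 2 / 3) ^ 3)⁻¹) r := by
  have hX : HasDerivAt (fun r : ℝ => (1 + r ^ 2 / 3) ^ 2) (2 * (1 + r ^ 2 / 3) * (2 * r / 3)) r := by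
    exact (((((hasDerivAt_id r).pow 2).div_const 3).const_add 1).pow 2).congr_deriv (by simp)
  have hpos : (1 + r ^ 2 / 3) ≠ 0 := by positivity
  refine ((hasDerivAt_groundPrimitive r).add
    (((hasDerivAt_pow 3 r).div hX (pow_ne_zero 2 hpos)).const_mul (1 / 3))).congr_deriv ?_
  have hpos' : (3 + r ^ 2) ≠ 0 := by positivity
  field_simp
  ring

lemma tendsto_ground_sextic :
    Tendsto (fun r => groundPrimitive r + 1 / 3 * (r ^ 3 / (1 + r ^ 2 / 3) ^ 2)) atTop
      (𝓝 blissConst) := by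
  have := tendsto_groundPrimitive.add (tendsto_cubic_div.const_mul (1 / 3))
  rwa [mul_zero, add_zero] at this

lemma integrableOn_ground_sextic :
    IntegrableOn (fun r : ℝ => r ^ 2 * ((1 + r ^ 2 / 3) ^ 3)⁻¹) (Ioi 0) :=
  integrableOn_Ioi_deriv_of_nonneg' (fun r _ => hasDerivAt_ground_sextic r)
    (fun r _ => by positivity) tendsto_ground_sextic

lemma integral_ground_sextic :
    ∫ r in Ioi (0 : ℝ), r ^ 2 * ((1 + r ^ 2 / 3) ^ 3)⁻¹ = blissConst := by
  rw [integral_Ioi_of_hasDerivAt_of_nonneg' (fun r _ => hasDerivAt_ground_sextic r)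
    (fun r _ => by positivity) tendsto_ground_sextic]
  simp [groundPrimitive]

end Bliss

section RadialSobolev

open Filter Topology Set

/-- The area of the unit sphere of `ℝ³`. -/
def sphereArea : ℝ := 3 * (volume : Measure E3).real (Metric.ball 0 1)

lemma sphereArea_pos : 0 < sphereArea := by
  have : 0 < (volume : Measure E3).real (Metric.ball 0 1) :=
    ENNReal.toReal_pos (Metric.measure_ball_pos _ _ one_pos).ne' measure_ball_lt_top.ne
  unfold sphereArea
  positivity

lemma integral_radial (F : ℝ → ℝ) :
    ∫ x : E3, F ‖x‖ = sphereArea * ∫ r in Ioi 0, r ^ 2 * F r := by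
  have := integral_fun_norm_addHaar (volume : Measure E3) F
  rw [this]
  simp [sphereArea, mul_assoc]

lemma integrable_radial_iff (F : ℝ → ℝ) :
    Integrable (fun x : E3 => F ‖x‖) ↔ IntegrableOn (fun r => r ^ 2 * F r) (Ioi 0) := by
  have := integrable_fun_norm_addHaar (volume : Measure E3) (f := F)
  simpa using this

/-- The squared gradient norm of the ground state. -/
def groundKinetic : ℝ := sphereArea * blissConst

lemma groundKinetic_pos : 0 < groundKinetic := mul_pos sphereArea_pos blissConst_pos

lemma rpow_neg_three_halves_sq {a : ℝ} (ha : 0 ≤ a) : (a ^ (-(3 : ℝ) / 2)) ^ 2 = (a ^ 3)⁻¹ := by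
  rw [← Real.rpow_natCast, ← Real.rpow_mul ha, ← Real.rpow_natCast, ← Real.rpow_neg ha]
  norm_num

lemma rpow_neg_half_pow_six {a : ℝ} (ha : 0 ≤ a) : (a ^ (-(1 : ℝ) / 2)) ^ 6 = (a ^ 3)⁻¹ := by
  rw [← Real.rpow_natCast, ← Real.rpow_mul ha, ← Real.rpow_natCast, ← Real.rpow_neg ha]
  norm_num

lemma hasFDerivAt_W (x : E3) : HasFDerivAt W
    ((-(1 : ℝ) / 2 * (1 + ‖x‖ ^ 2 / 3) ^ (-(1 : ℝ) / 2 - 1)) •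
      ((1 / 3 : ℝ) • (2 • (innerSL ℝ x : E3 →L[ℝ] ℝ)))) x := by
  have h1 : HasFDerivAt (fun y : E3 => 1 + ‖y‖ ^ 2 / 3)
      ((1 / 3 : ℝ) • (2 • (innerSL ℝ x : E3 →L[ℝ] ℝ))) x := by
    have := ((hasStrictFDerivAt_norm_sq x).hasFDerivAt.const_mul (1 / 3 : ℝ)).const_add 1
    exact this.congr_of_eventuallyEq (Eventually.of_forall fun y => by simp only; ring)
  exact h1.rpow_const (Or.inl (by positivity))

lemma pdR_W (i : Fin 3) (x : E3) :
    pdR i W x = -(x i / 3) * (1 + ‖x‖ ^ 2 / 3) ^ (-(3 : ℝ) / 2) := by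
  have hin : inner ℝ x (e3 i) = x i := by
    rw [e3, EuclideanSpace.inner_single_right]; simp
  rw [pdR, (hasFDerivAt_W x).fderiv]
  have hexp : (-(1 : ℝ) / 2 - 1) = -3 / 2 := by norm_num
  simp only [hexp, smul_apply, smul_eq_mul, innerSL_apply_apply, hin, nsmul_eq_mul, Nat.cast_ofNat]
  ring

lemma gradSqR_W (x : E3) :
    gradSqR W x = ‖x‖ ^ 2 / 9 * ((1 + ‖x‖ ^ 2 / 3) ^ 3)⁻¹ := by
  have hpow := rpow_neg_three_halves_sq (a := 1 + ‖x‖ ^ 2 / 3) (by positivity)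
  have hn : ‖x‖ ^ 2 = x 0 ^ 2 + x 1 ^ 2 + x 2 ^ 2 := by
    rw [EuclideanSpace.real_norm_sq_eq, Fin.sum_univ_three]
  simp only [gradSqR, pdR_W, Fin.sum_univ_three, mul_pow, hpow]
  rw [hn]
  ring

lemma W_pow_six (x : E3) : W x ^ 6 = ((1 + ‖x‖ ^ 2 / 3) ^ 3)⁻¹ :=
  rpow_neg_half_pow_six (by positivity)

lemma integral_gradSqR_W : ∫ x : E3, gradSqR W x = groundKinetic := by
  simp only [gradSqR_W]
  rw [integral_radial fun r => r ^ 2 / 9 * ((1 + r ^ 2 / 3) ^ 3)⁻¹, integral_ground_kinetic,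
    groundKinetic]

lemma gradSqC_Wc (x : E3) : gradSqC Wc x = gradSqR W x := by
  have h (i : Fin 3) : pdC i Wc x = (pdR i W x : ℂ) := by
    have h1 := Complex.ofRealCLM.hasFDerivAt.comp x (hasFDerivAt_W x)
    have h2 : HasFDerivAt Wc _ x := h1
    rw [pdC, h2.fderiv, pdR, (hasFDerivAt_W x).fderiv]
    rfl
  simp [gradSqC, gradSqR, h]

lemma Ecrit_Wc : Ecrit Wc = groundKinetic / 3 := by
  have hint1 := (integrable_radial_iff fun r => r ^ 2 / 9 * ((1 + r ^ 2 / 3) ^ 3)⁻¹).2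
    integrableOn_ground_kinetic
  have hint2 := (integrable_radial_iff fun r => ((1 + r ^ 2 / 3) ^ 3)⁻¹).2
    integrableOn_ground_sextic
  have hnorm (x : E3) : ‖Wc x‖ ^ 6 = ((1 + ‖x‖ ^ 2 / 3) ^ 3)⁻¹ := by
    rw [Wc, Complex.norm_real, Real.norm_eq_abs, Even.pow_abs (by decide), W_pow_six]
  simp only [Ecrit, gradSqC_Wc, gradSqR_W, hnorm]
  rw [integral_sub (hint1.const_mul _) (hint2.const_mul _), integral_const_mul, integral_const_mul,
    integral_radial fun r => r ^ 2 / 9 * ((1 + r ^ 2 / 3) ^ 3)⁻¹,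
    integral_radial fun r => ((1 + r ^ 2 / 3) ^ 3)⁻¹, integral_ground_kinetic,
    integral_ground_sextic, groundKinetic]
  ring

lemma norm_smul_e3 (r : ℝ) (i : Fin 3) : ‖r • e3 i‖ = |r| := by
  rw [norm_smul, e3, PiLp.norm_single, norm_one, mul_one, Real.norm_eq_abs]

lemma hasFDerivAt_norm_of_ne {x : E3} (hx : x ≠ 0) :
    HasFDerivAt (fun y : E3 => ‖y‖) (‖x‖⁻¹ • (innerSL ℝ x : E3 →L[ℝ] ℝ)) x := by
  have hne : ‖x‖ ≠ 0 := norm_ne_zero_iff.2 hx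
  have h := ((hasStrictFDerivAt_norm_sq x).hasFDerivAt).sqrt (pow_ne_zero 2 hne)
  simp only [Real.sqrt_sq (norm_nonneg _)] at h
  refine h.congr_fderiv ?_
  ext y
  simp only [smul_apply, smul_eq_mul, innerSL_apply_apply, nsmul_eq_mul, Nat.cast_ofNat]
  field_simp

lemma gradSqC_radial {f : E3 → ℂ} {φ φ' : ℝ → ℂ} (hf : ∀ x, f x = φ ‖x‖)
    (hφ : ∀ r, HasDerivAt φ (φ' r) r) {x : E3} (hx : x ≠ 0) :
    gradSqC f x = ‖φ' ‖x‖‖ ^ 2 := by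
  have hne : ‖x‖ ≠ 0 := norm_ne_zero_iff.2 hx
  have hd := ((hφ ‖x‖).hasFDerivAt.comp x (hasFDerivAt_norm_of_ne hx)).congr_of_eventuallyEq
    (Eventually.of_forall hf)
  have hpd (i : Fin 3) : pdC i f x = ((x i / ‖x‖ : ℝ) : ℂ) * φ' ‖x‖ := by
    have hin : inner ℝ x (e3 i) = x i := by
      rw [e3, EuclideanSpace.inner_single_right]; simp
    rw [pdC, hd.fderiv]
    simp only [ContinuousLinearMap.comp_apply, smul_apply, innerSL_apply_apply, hin,
      ContinuousLinearMap.toSpanSingleton_apply, smul_eq_mul]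
    rw [Complex.real_smul]
    congr 2
    ring
  have hn : ‖x‖ ^ 2 = x 0 ^ 2 + x 1 ^ 2 + x 2 ^ 2 := by
    rw [EuclideanSpace.real_norm_sq_eq, Fin.sum_univ_three]
  simp only [gradSqC, hpd, Fin.sum_univ_three, norm_mul, Complex.norm_real, mul_pow,
    Real.norm_eq_abs, sq_abs, div_pow]
  rw [← add_mul, ← add_mul, ← add_div, ← add_div, ← hn, div_self (pow_ne_zero 2 hne), one_mul]

/-- The sharp Sobolev inequality for radial functions on `ℝ³`. -/
theorem radial_sobolev {f : E3 → ℂ} (hf : ContDiff ℝ (⊤ : ℕ∞) f)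
    (hrad : ∀ x y : E3, ‖x‖ = ‖y‖ → f x = f y) (hdecay : ∃ C, ∀ x, ‖x‖ * ‖f x‖ ≤ C)
    (hK : Integrable (gradSqC f)) (hP : Integrable fun x => ‖f x‖ ^ 6) :
    groundKinetic ^ 2 * ∫ x, ‖f x‖ ^ 6 ≤ (∫ x, gradSqC f x) ^ 3 := by
  set φ : ℝ → ℂ := fun r => f (r • e3 0)
  have hφs : ContDiff ℝ (⊤ : ℕ∞) φ := hf.comp (contDiff_id.smul contDiff_const)
  have hφ (r : ℝ) : HasDerivAt φ (deriv φ r) r :=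
    (hφs.differentiable (by simp) r).hasDerivAt
  have hφc : Continuous (deriv φ) := hφs.continuous_deriv (by simp)
  have hfφ (x : E3) : f x = φ ‖x‖ := hrad _ _ (by rw [norm_smul_e3, abs_norm])
  have hgrad : gradSqC f =ᵐ[volume] fun x => ‖deriv φ ‖x‖‖ ^ 2 := by
    filter_upwards [compl_mem_ae_iff.2 (measure_singleton (0 : E3))] with x hx
    exact gradSqC_radial hfφ hφ hx
  have hsix : (fun x => ‖f x‖ ^ 6) = fun x => (fun r => ‖φ r‖ ^ 6) ‖x‖ := by
    ext x; rw [hfφ x]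
  have hK' := (integrable_radial_iff fun r => ‖deriv φ r‖ ^ 2).1 (hK.congr hgrad)
  rw [hsix] at hP ⊢
  have hP' := (integrable_radial_iff fun r => ‖φ r‖ ^ 6).1 hP
  obtain ⟨C, hC⟩ := hdecay
  have hlim : Tendsto (fun r => r * ‖φ r‖ ^ 2) atTop (𝓝 0) := by
    refine squeeze_zero' (g := fun r : ℝ => C ^ 2 * r⁻¹) ?_ ?_ ?_
    · filter_upwards [eventually_gt_atTop 0] with r hr using by positivity
    · filter_upwards [eventually_gt_atTop 0] with r hr
      have h := hC (r • e3 0)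
      rw [norm_smul_e3, abs_of_pos hr] at h
      have h2 : (r * ‖φ r‖) ^ 2 ≤ C ^ 2 := pow_le_pow_left₀ (by positivity) h 2
      rw [← div_eq_mul_inv, le_div_iff₀ hr]
      calc _ = (r * ‖φ r‖) ^ 2 := by ring
        _ ≤ _ := h2
    · simpa using tendsto_inv_atTop_zero.const_mul (C ^ 2)
  have hb := bliss_inequality hφ hφc hlim hK' hP'
  rw [integral_congr_ae hgrad, integral_radial fun r => ‖deriv φ r‖ ^ 2,
    integral_radial fun r => ‖φ r‖ ^ 6, groundKinetic]
  have := mul_le_mul_of_nonneg_left hb (pow_nonneg sphereArea_pos.le 3)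
  linarith

end RadialSobolev

section Functionals

lemma pdS_conjS_apply (i : Fin 3) (u : smoothAlg) (t : ℝ) (x : E3) :
    (pdS i (conjS u)).1 t x = (starRingEnd ℂ) ((pdS i u).1 t x) := by
  rw [pdS_conjS, conjS_apply]

lemma mul_conjS_apply (u : smoothAlg) (t : ℝ) (x : E3) :
    (u * conjS u).1 t x = ((‖u.1 t x‖ ^ 2 : ℝ) : ℂ) := by
  rw [coe_mul_apply, conjS_apply, Complex.mul_conj, Complex.normSq_eq_norm_sq]

lemma quartic_apply (u : smoothAlg) (t : ℝ) (x : E3) :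
    (u * conjS u * (u * conjS u)).1 t x = ((‖u.1 t x‖ ^ 4 : ℝ) : ℂ) := by
  rw [coe_mul_apply, mul_conjS_apply]
  push_cast
  ring

lemma sextic_apply (u : smoothAlg) (t : ℝ) (x : E3) :
    (u * conjS u * (u * conjS u) * (u * conjS u)).1 t x = ((‖u.1 t x‖ ^ 6 : ℝ) : ℂ) := by
  rw [coe_mul_apply, quartic_apply, mul_conjS_apply]
  push_cast
  ring

lemma kinetic_apply (u : smoothAlg) (t : ℝ) (x : E3) :
    (kinetic u (conjS u)).1 t x = ((gradSqC (u.1 t) x : ℝ) : ℂ) := by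
  simp only [kinetic, Fin.sum_univ_three, coe_add_apply, coe_mul_apply, pdS_conjS_apply,
    Complex.mul_conj, Complex.normSq_eq_norm_sq, gradSqC]
  push_cast
  rfl

lemma varianceDensity_apply (u : smoothAlg) (t : ℝ) (x : E3) :
    (varianceDensity u (conjS u)).1 t x = ((‖x‖ ^ 2 * ‖u.1 t x‖ ^ 2 : ℝ) : ℂ) := by
  have hn : ‖x‖ ^ 2 = x 0 ^ 2 + x 1 ^ 2 + x 2 ^ 2 := by
    rw [EuclideanSpace.real_norm_sq_eq, Fin.sum_univ_three]
  rw [hn]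
  have hc (j : Fin 3) : (coordS j * (coordS j * (u * conjS u))).1 t x =
      ((x j : ℝ) : ℂ) * (((x j : ℝ) : ℂ) * ((‖u.1 t x‖ ^ 2 : ℝ) : ℂ)) := by
    rw [← mul_conjS_apply]
    rfl
  simp only [varianceDensity, Fin.sum_univ_three, coe_add_apply, hc]
  push_cast
  ring

lemma momentumDensity_apply (u : smoothAlg) (t : ℝ) (x : E3) :
    (momentumDensity u (conjS u)).1 t x =
      ((4 * ∑ j, x j * ((starRingEnd ℂ) (u.1 t x) * pdC j (u.1 t) x).im : ℝ) : ℂ) := by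
  simp only [momentumDensity, Fin.sum_univ_three, coe_smul_apply, coe_add_apply, coe_mul_apply,
    coe_sub_apply, pdS_conjS_apply, conjS_apply, coordS_apply, pdS_apply]
  apply Complex.ext <;> simp
  ring

lemma energyDensity_apply (u : smoothAlg) (t : ℝ) (x : E3) :
    (energyDensity u (conjS u)).1 t x =
      ((1 / 2 * gradSqC (u.1 t) x - 1 / 6 * ‖u.1 t x‖ ^ 6 + 1 / 4 * ‖u.1 t x‖ ^ 4 : ℝ) : ℂ) := by
  rw [energyDensity, coe_add_apply, coe_sub_apply, coe_smul_apply, coe_smul_apply, coe_smul_apply,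
    sextic_apply, quartic_apply, kinetic_apply]
  push_cast
  rfl

/-- The wave function multiplied by the quadratic phase `e^{iλ|x|²}`. -/
def chirp (l : ℝ) (f : E3 → ℂ) (x : E3) : ℂ :=
  Complex.exp (((l * ‖x‖ ^ 2 : ℝ) : ℂ) * Complex.I) * f x

lemma norm_chirp (l : ℝ) (f : E3 → ℂ) (x : E3) : ‖chirp l f x‖ = ‖f x‖ := by
  rw [chirp, norm_mul, Complex.norm_exp_ofReal_mul_I, one_mul]

lemma contDiff_chirp (l : ℝ) {f : E3 → ℂ} (hf : ContDiff ℝ (⊤ : ℕ∞) f) :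
    ContDiff ℝ (⊤ : ℕ∞) (chirp l f) := by
  have h1 : ContDiff ℝ (⊤ : ℕ∞) fun x : E3 => ((l * ‖x‖ ^ 2 : ℝ) : ℂ) :=
    Complex.ofRealCLM.contDiff.comp (contDiff_const.mul (contDiff_norm_sq ℝ))
  exact (h1.mul contDiff_const).cexp.mul hf

lemma pdC_chirp (l : ℝ) {f : E3 → ℂ} (hf : Differentiable ℝ f) (i : Fin 3) (x : E3) :
    pdC i (chirp l f) x = Complex.exp (((l * ‖x‖ ^ 2 : ℝ) : ℂ) * Complex.I) *
      (pdC i f x + ((2 * l * x i : ℝ) : ℂ) * Complex.I * f x) := by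
  have hin : inner ℝ x (e3 i) = x i := by
    rw [e3, EuclideanSpace.inner_single_right]; simp
  have h0 := Complex.ofRealCLM.hasFDerivAt.comp x
    ((hasStrictFDerivAt_norm_sq x).hasFDerivAt.const_mul l)
  have h1 := ((h0.mul_const Complex.I).cexp).mul (hf x).hasFDerivAt
  have h2 : fderiv ℝ (chirp l f) x = _ := h1.fderiv
  rw [pdC, h2]
  simp [hin, pdC]
  ring

lemma gradSqC_chirp (l : ℝ) (u : smoothAlg) (t : ℝ) (x : E3) :
    gradSqC (chirp l (u.1 t)) x = ((kinetic u (conjS u)).1 t x).re +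
      l * ((momentumDensity u (conjS u)).1 t x).re +
      4 * l ^ 2 * ((varianceDensity u (conjS u)).1 t x).re := by
  have hn : ‖x‖ ^ 2 = x 0 ^ 2 + x 1 ^ 2 + x 2 ^ 2 := by
    rw [EuclideanSpace.real_norm_sq_eq, Fin.sum_univ_three]
  rw [kinetic_apply, momentumDensity_apply, varianceDensity_apply, hn]
  simp only [gradSqC, pdC_chirp l (smoothAlg_differentiable u t), norm_mul,
    Complex.norm_exp_ofReal_mul_I, one_mul, Fin.sum_univ_three, Complex.ofReal_re]
  simp only [← Complex.normSq_eq_norm_sq, Complex.normSq_apply]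
  simp
  ring

lemma intS_re {f : smoothAlg} (hf : IsSchwartz f) (t : ℝ) :
    (intS f t).re = ∫ x, (f.1 t x).re :=
  (Complex.reCLM.integral_comp_comm (hf.integrable t)).symm

lemma integrable_re {f : smoothAlg} (hf : IsSchwartz f) (t : ℝ) :
    Integrable fun x => (f.1 t x).re := (hf.integrable t).re

variable {u : smoothAlg}

lemma intS_kinetic_re (hu : IsSchwartz u) (t : ℝ) :
    (intS (kinetic u (conjS u)) t).re = ∫ x, gradSqC (u.1 t) x := by
  rw [intS_re (hu.kinetic hu.conjS)]
  simp only [kinetic_apply, Complex.ofReal_re]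

lemma intS_energyDensity_re (hu : IsSchwartz u) (t : ℝ) :
    (intS (energyDensity u (conjS u)) t).re = Ecq (u.1 t) := by
  rw [intS_re (hu.energyDensity hu.conjS)]
  simp only [energyDensity_apply, Complex.ofReal_re, Ecq]

lemma intS_energyDensity (hu : IsSchwartz u) (t : ℝ) :
    intS (energyDensity u (conjS u)) t = 1 / 2 * intS (kinetic u (conjS u)) t -
      1 / 6 * intS (u * conjS u * (u * conjS u) * (u * conjS u)) t +
      1 / 4 * intS (u * conjS u * (u * conjS u)) t := by
  have hv := hu.conjS
  have hs := (hu.sextic hv).smul (1 / 6)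
  have hsub : intS ((1 / 2 : ℂ) • kinetic u (conjS u) -
      (1 / 6 : ℂ) • (u * conjS u * (u * conjS u) * (u * conjS u))) t = _ :=
    integral_sub (((hu.kinetic hv).smul (1 / 2)).integrable t) (hs.integrable t)
  rw [energyDensity, intS_add (((hu.kinetic hv).smul _).sub hs) ((hu.quartic hv).smul _), hsub]
  congr 1
  · congr 1 <;> exact intS_smul _ _ _
  · exact intS_smul _ _ _

lemma intS_virialDensity (hu : IsSchwartz u) (t : ℝ) :
    intS (virialDensity u (conjS u)) t = 8 * intS (kinetic u (conjS u)) t +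
      6 * intS (u * conjS u * (u * conjS u)) t -
      8 * intS (u * conjS u * (u * conjS u) * (u * conjS u)) t := by
  have hv := hu.conjS
  have hk := (hu.kinetic hv).smul 8
  have hq := (hu.quartic hv).smul 6
  have hsub : intS (virialDensity u (conjS u)) t = _ :=
    integral_sub ((hk.add hq).integrable t) (((hu.sextic hv).smul 8).integrable t)
  rw [hsub]
  congr 1
  · refine (intS_add hk hq t).trans ?_
    rw [intS_smul, intS_smul]
  · exact intS_smul _ _ _

/-- The sharp Sobolev inequality applied to a radial function with an arbitrary quadratic phase. -/
lemma radial_sobolev_chirp (hu : IsSchwartz u) (hrad : ∀ t x y, ‖x‖ = ‖y‖ → u.1 t x = u.1 t y)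
    (l t : ℝ) :
    groundKinetic ^ 2 * (intS (u * conjS u * (u * conjS u) * (u * conjS u)) t).re ≤
      ((intS (kinetic u (conjS u)) t).re + l * (intS (momentumDensity u (conjS u)) t).re +
        4 * l ^ 2 * (intS (varianceDensity u (conjS u)) t).re) ^ 3 := by
  have hv := hu.conjS
  have hk := integrable_re (hu.kinetic hv) t
  have hm := integrable_re (hu.momentumDensity hv) t
  have hw := integrable_re (hu.varianceDensity hv) t
  have hs := integrable_re (hu.sextic hv) t
  have hg : gradSqC (chirp l (u.1 t)) = fun x => ((kinetic u (conjS u)).1 t x).re +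
      l * ((momentumDensity u (conjS u)).1 t x).re +
      4 * l ^ 2 * ((varianceDensity u (conjS u)).1 t x).re := funext (gradSqC_chirp l u t)
  have hsix : (fun x => ‖chirp l (u.1 t) x‖ ^ 6) =
      fun x => ((u * conjS u * (u * conjS u) * (u * conjS u)).1 t x).re := by
    ext x
    rw [norm_chirp, sextic_apply, Complex.ofReal_re]
  have h := radial_sobolev (f := chirp l (u.1 t)) (contDiff_chirp l (u.2 t))
    (fun x y hxy => by rw [chirp, chirp, hxy, hrad t x y hxy]) ?_
    (by rw [hg]; exact (hk.add (hm.const_mul l)).add (hw.const_mul _)) (by rw [hsix]; exact hs)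
  · rw [hg, hsix] at h
    rw [intS_re (hu.sextic hv), intS_re (hu.kinetic hv), intS_re (hu.momentumDensity hv),
      intS_re (hu.varianceDensity hv)]
    have hi : (∫ x, (((kinetic u (conjS u)).1 t x).re +
        l * ((momentumDensity u (conjS u)).1 t x).re +
        4 * l ^ 2 * ((varianceDensity u (conjS u)).1 t x).re)) = _ :=
      integral_add (hk.add (hm.const_mul l)) (hw.const_mul (4 * l ^ 2))
    have hi' : (∫ x, (((kinetic u (conjS u)).1 t x).re +
        l * ((momentumDensity u (conjS u)).1 t x).re)) = _ :=
      integral_add hk (hm.const_mul l)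
    rwa [hi, hi', integral_const_mul, integral_const_mul] at h
  · obtain ⟨C, hC⟩ := hu.decays t 1
    refine ⟨C, fun x => ?_⟩
    rw [norm_chirp]
    refine le_trans ?_ (hC t le_rfl x)
    rw [pow_one]
    gcongr
    linarith

end Functionals

section RegularSolutions

open Set Filter Topology

variable {u : ℝ → E3 → ℂ}

lemma uniqueDiffOn_halfSpace : UniqueDiffOn ℝ (Ici (0 : ℝ) ×ˢ (univ : Set E3)) :=
  (uniqueDiffOn_Ici 0).prod uniqueDiffOn_univ

lemma IsRegularSolution.contDiff_slice (h : IsRegularSolution (Ici 0) u) {t : ℝ} (ht : 0 ≤ t) :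
    ContDiff ℝ (⊤ : ℕ∞) (u t) := by
  have hp : ContDiff ℝ (⊤ : ℕ∞) fun x : E3 => (t, x) := contDiff_const.prodMk contDiff_id
  exact contDiffOn_univ.1 (h.1.comp hp.contDiffOn fun x _ => ⟨ht, trivial⟩)

/-- A regular solution on `[0, ∞)`, extended to negative times by its initial value. -/
def IsRegularSolution.extend (h : IsRegularSolution (Ici 0) u) : smoothAlg :=
  ⟨fun t => u (max t 0), fun _ => h.contDiff_slice (le_max_right _ _)⟩

lemma IsRegularSolution.extend_of_nonneg (h : IsRegularSolution (Ici 0) u) {t : ℝ} (ht : 0 ≤ t) :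
    h.extend.1 t = u t := by
  change u (max t 0) = u t
  rw [max_eq_left ht]

lemma IsRegularSolution.extend_eventuallyEq (h : IsRegularSolution (Ici 0) u) {t : ℝ}
    (ht : 0 < t) : h.extend.1 =ᶠ[𝓝 t] u := by
  filter_upwards [lt_mem_nhds ht] with s hs using h.extend_of_nonneg hs.le

lemma IsRegularSolution.isSchwartz (h : IsRegularSolution (Ici 0) u) : IsSchwartz h.extend := by
  refine isSchwartz_of_iteratedFDeriv fun T n k => ?_
  obtain ⟨C, hC⟩ := h.2.2 (Icc 0 (max T 0)) isCompact_Icc (fun t ht => ht.1) n k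
  exact ⟨C, fun t ht x => hC _ ⟨le_max_right _ _, max_le_max_right 0 ht⟩ x⟩

lemma IsRegularSolution.pdC_eq (h : IsRegularSolution (Ici 0) u) {t : ℝ} (ht : 0 ≤ t)
    (i : Fin 3) (x : E3) :
    pdC i (u t) x = fderivWithin ℝ (fun p : ℝ × E3 => u p.1 p.2) (Ici 0 ×ˢ univ) (t, x)
      (0, e3 i) := by
  have h1 : HasFDerivWithinAt (fun p : ℝ × E3 => u p.1 p.2) _ (Ici 0 ×ˢ univ) (t, x) :=
    (h.1.differentiableOn (by simp) (t, x) ⟨ht, trivial⟩).hasFDerivWithinAt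
  have h2 := h1.comp_hasFDerivAt x (hasFDerivAt_prodMk_right t x)
    (Eventually.of_forall fun y => ⟨ht, trivial⟩)
  have h3 : HasFDerivAt (u t) _ x := h2
  rw [pdC, h3.fderiv]
  rfl

lemma IsRegularSolution.continuous_time (h : IsRegularSolution (Ici 0) u) (x : E3) :
    Continuous fun t => h.extend.1 t x :=
  h.1.continuousOn.comp_continuous (f := fun t : ℝ => (max t 0, x)) (by fun_prop)
    fun _ => ⟨mem_Ici.2 (le_max_right _ _), trivial⟩

lemma IsRegularSolution.continuous_time_pdS (h : IsRegularSolution (Ici 0) u) (i : Fin 3)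
    (x : E3) : Continuous fun t => (pdS i h.extend).1 t x := by
  have h1 := (h.1.continuousOn_fderivWithin uniqueDiffOn_halfSpace (by simp)).comp_continuous
    (f := fun t : ℝ => (max t 0, x)) (by fun_prop) fun _ => ⟨mem_Ici.2 (le_max_right _ _), trivial⟩
  refine (h1.clm_apply (continuous_const (y := ((0 : ℝ), e3 i)))).congr fun t => ?_
  exact (h.pdC_eq (le_max_right _ _) i x).symm

lemma IsRegularSolution.contDiffAt (h : IsRegularSolution (Ici 0) u) {t : ℝ} (ht : 0 < t)
    (x : E3) : ContDiffAt ℝ (⊤ : ℕ∞) (fun p : ℝ × E3 => u p.1 p.2) (t, x) :=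
  h.1.contDiffAt (prod_mem_nhds (Ici_mem_nhds ht) univ_mem)

lemma IsRegularSolution.hasDerivAt (h : IsRegularSolution (Ici 0) u) {t : ℝ} (ht : 0 < t)
    (x : E3) : HasDerivAt (fun s => u s x)
      (fderiv ℝ (fun p : ℝ × E3 => u p.1 p.2) (t, x) (1, 0)) t := by
  have h1 : HasFDerivAt (fun p : ℝ × E3 => u p.1 p.2) _ (t, x) :=
    ((h.contDiffAt ht x).differentiableAt (by simp)).hasFDerivAt
  exact h1.comp_hasDerivAt t ((hasDerivAt_id t).prodMk (hasDerivAt_const t x))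

lemma IsRegularSolution.equation (h : IsRegularSolution (Ici 0) u) {t : ℝ} (ht : 0 < t)
    (x : E3) : fderiv ℝ (fun p : ℝ × E3 => u p.1 p.2) (t, x) (1, 0) =
      (Complex.I • nlsRHS h.extend (conjS h.extend)).1 t x := by
  have h1 := h.2.1 t ht.le x
  rw [(h.hasDerivAt ht x).deriv] at h1
  have h2 : (nlsRHS h.extend (conjS h.extend)).1 t x =
      lapC (u t) x - (‖u t x‖ : ℂ) ^ 2 * u t x + (‖u t x‖ : ℂ) ^ 4 * u t x := by
    have hlap : (lapS h.extend).1 t x = lapC (u t) x := by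
      simp only [lapS, lapC, Fin.sum_univ_three, coe_add_apply, pdS_apply,
        h.extend_of_nonneg ht.le]
    have hc := Complex.mul_conj (u t x)
    rw [Complex.normSq_eq_norm_sq, Complex.ofReal_pow] at hc
    rw [nlsRHS, coe_add_apply, coe_sub_apply, hlap]
    simp only [coe_mul_apply, conjS_apply, h.extend_of_nonneg ht.le]
    rw [show (‖u t x‖ : ℂ) ^ 4 = ((‖u t x‖ : ℂ) ^ 2) ^ 2 by ring, ← hc]
    ring
  rw [coe_smul_apply, h2]
  linear_combination (-Complex.I) * h1 +
    fderiv ℝ (fun p : ℝ × E3 => u p.1 p.2) (t, x) (1, 0) * Complex.I_sq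

lemma IsRegularSolution.hasTimeDeriv (h : IsRegularSolution (Ici 0) u) :
    HasTimeDeriv h.extend (Complex.I • nlsRHS h.extend (conjS h.extend)) := by
  intro t ht x
  rw [← h.equation ht x]
  exact (h.hasDerivAt ht x).congr_of_eventuallyEq
    ((h.extend_eventuallyEq ht).mono fun s hs => by simp only [hs])

lemma IsRegularSolution.hasTimeDeriv_pdS (h : IsRegularSolution (Ici 0) u) (i : Fin 3) :
    HasTimeDeriv (pdS i h.extend)
      (Complex.I • pdS i (nlsRHS h.extend (conjS h.extend))) := by
  intro t ht x
  set U : ℝ × E3 → ℂ := fun p => u p.1 p.2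
  have hsymm : IsSymmSndFDerivAt ℝ U (t, x) := (h.contDiffAt ht x).isSymmSndFDerivAt
    (by simpa using WithTop.coe_le_coe.2 (le_top : (2 : ℕ∞) ≤ ⊤))
  have hd : HasFDerivAt (fderiv ℝ U) (fderiv ℝ (fderiv ℝ U) (t, x)) (t, x) :=
    (((h.contDiffAt ht x).fderiv_right (m := (⊤ : ℕ∞)) (by simp)).differentiableAt
      (by simp)).hasFDerivAt
  have htime : HasDerivAt (fun s => fderiv ℝ U (s, x) (0, e3 i))
      (fderiv ℝ (fderiv ℝ U) (t, x) (1, 0) (0, e3 i)) t := by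
    have h1 := hd.comp_hasDerivAt t ((hasDerivAt_id t).prodMk (hasDerivAt_const t x))
    have h2 := h1.clm_apply (hasDerivAt_const t ((0 : ℝ), e3 i))
    simpa using h2
  have hspace : (Complex.I • pdS i (nlsRHS h.extend (conjS h.extend))).1 t x =
      fderiv ℝ (fderiv ℝ U) (t, x) (0, e3 i) (1, 0) := by
    rw [← Derivation.map_smul, pdS_apply]
    have h0 : (Complex.I • nlsRHS h.extend (conjS h.extend)).1 t =
        fun y => fderiv ℝ U (t, y) (1, 0) := funext fun y => (h.equation ht y).symm
    have h1 := hd.comp x (hasFDerivAt_prodMk_right t x)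
    have h2 := h1.clm_apply (hasFDerivAt_const ((1 : ℝ), (0 : E3)) x)
    have h3 : HasFDerivAt (fun y => fderiv ℝ U (t, y) (1, 0)) _ x := h2
    rw [h0, pdC, h3.fderiv]
    simp
  rw [hspace, hsymm (0, e3 i) (1, 0)]
  refine htime.congr_of_eventuallyEq ?_
  filter_upwards [lt_mem_nhds ht] with s hs
  rw [pdS_apply, h.extend_of_nonneg hs.le, h.pdC_eq hs.le i x,
    fderivWithin_of_mem_nhds (prod_mem_nhds (Ici_mem_nhds hs) univ_mem)]

lemma conjS_nlsRHS (f : smoothAlg) :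
    conjS (Complex.I • nlsRHS f (conjS f)) = -Complex.I • nlsRHS (conjS f) f := by
  refine Subtype.ext <| funext fun t => funext fun x => ?_
  have hlap : (lapS (conjS f)).1 t x = (starRingEnd ℂ) ((lapS f).1 t x) := by
    simp only [lapS, pdS_conjS, Fin.sum_univ_three, coe_add_apply, conjS_apply, map_add]
  simp only [nlsRHS, conjS_apply, coe_add_apply, coe_sub_apply, coe_smul_apply, coe_mul_apply,
    map_add, map_sub, map_mul, hlap, Complex.conj_I, Complex.conj_conj]

lemma IsRegularSolution.isNLSPair (h : IsRegularSolution (Ici 0) u) :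
    IsNLSPair h.extend (conjS h.extend) where
  schwartz_left := h.isSchwartz
  schwartz_right := h.isSchwartz.conjS
  deriv_left := h.hasTimeDeriv
  deriv_right := by
    rw [← conjS_nlsRHS]
    exact h.hasTimeDeriv.conjS
  deriv_pd_left := h.hasTimeDeriv_pdS
  deriv_pd_right := fun i => by
    rw [← Derivation.map_smul, ← conjS_nlsRHS, pdS_conjS, pdS_conjS, Derivation.map_smul]
    exact (h.hasTimeDeriv_pdS i).conjS

lemma IsRegularSolution.continuous_kinetic (h : IsRegularSolution (Ici 0) u) (x : E3) :
    Continuous fun t => (kinetic h.extend (conjS h.extend)).1 t x := by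
  have hp := fun i => h.continuous_time_pdS i x
  simp only [kinetic, Fin.sum_univ_three, coe_add_apply, coe_mul_apply, pdS_conjS_apply]
  fun_prop

lemma IsRegularSolution.continuous_intS_kinetic (h : IsRegularSolution (Ici 0) u) :
    Continuous (intS (kinetic h.extend (conjS h.extend))) :=
  continuous_intS (h.isSchwartz.kinetic h.isSchwartz.conjS).decays h.continuous_kinetic

lemma IsRegularSolution.continuous_intS_energyDensity (h : IsRegularSolution (Ici 0) u) :
    Continuous (intS (energyDensity h.extend (conjS h.extend))) := by
  refine continuous_intS (h.isSchwartz.energyDensity h.isSchwartz.conjS).decays fun x => ?_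
  have hc := h.continuous_time x
  have hq := hc.mul (Complex.continuous_conj.comp hc)
  exact ((continuous_const.mul (h.continuous_kinetic x)).sub
    (continuous_const.mul ((hq.mul hq).mul hq))).add (continuous_const.mul (hq.mul hq))

end RegularSolutions

section VirialArgument

open Set Filter Topology

lemma le_of_hasDerivAt_nonpos {f f' : ℝ → ℝ} {a : ℝ} (hf : ∀ t ≥ a, HasDerivAt f (f' t) t)
    (hf' : ∀ t ≥ a, f' t ≤ 0) {t : ℝ} (ht : a ≤ t) : f t ≤ f a := by
  refine antitoneOn_of_deriv_nonpos (convex_Ici a)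
    (fun x hx => (hf x hx).continuousAt.continuousWithinAt) ?_ ?_ self_mem_Ici ht ht
  · exact fun x hx => (hf x (interior_subset hx)).differentiableAt.differentiableWithinAt
  · intro x hx
    rw [(hf x (interior_subset hx)).deriv]
    exact hf' x (interior_subset hx)

lemma exists_neg_of_hasDerivAt_le {f f' : ℝ → ℝ} {a c : ℝ} (hc : 0 < c)
    (hf : ∀ t ≥ a, HasDerivAt f (f' t) t) (hf' : ∀ t ≥ a, f' t ≤ -c) : ∃ t ≥ a, f t < 0 := by
  have hpos : 0 ≤ |f a| / c := by positivity
  have h := le_of_hasDerivAt_nonpos (f := fun t => f t + c * t) (f' := fun t => f' t + c * 1)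
    (fun t ht => (hf t ht).add ((hasDerivAt_id t).const_mul c))
    (fun t ht => by linarith [hf' t ht]) (t := a + |f a| / c + 1) (by linarith)
  refine ⟨a + |f a| / c + 1, by linarith, ?_⟩
  have h1 : c * (a + |f a| / c + 1) = c * a + |f a| + c := by field_simp
  simp only [h1] at h
  linarith [le_abs_self (f a)]

lemma cube_le_of_nonneg {k q : ℝ} (hk : 0 < k) (hq : 0 ≤ q) :
    (k + q - q ^ 2 / k) ^ 3 ≤ k ^ 2 * (k + 3 * q) := by
  obtain ⟨r, rfl⟩ : ∃ r, q = k * r := ⟨q / k, by field_simp⟩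
  have hr : 0 ≤ r := nonneg_of_mul_nonneg_right hq hk
  have h1 : k + k * r - (k * r) ^ 2 / k = k * (1 + r - r ^ 2) := by field_simp
  have h2 : (1 + r - r ^ 2) ^ 3 ≤ 1 + 3 * r := by
    have h3 : 3 * r ^ 2 - r ^ 3 ≤ 5 := by
      nlinarith [mul_nonneg (add_nonneg hr zero_le_one) (sq_nonneg (r - 2))]
    nlinarith [mul_nonneg (pow_nonneg hr 3) (sub_nonneg.2 h3)]
  rw [h1]
  nlinarith [mul_le_mul_of_nonneg_left h2 (pow_pos hk 3).le]

/-- Momentum is controlled by the variance and the dissipation of the virial identity. -/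
lemma momentum_sq_le {k K P Q V Y : ℝ} (hk : 0 < k) (hK : k ≤ K) (hP : 0 ≤ P)
    (hV : 0 ≤ V) (hE : K / 2 - Q / 6 + P / 4 = k / 3)
    (hS : ∀ l, k ^ 2 * Q ≤ (K + l * Y + 4 * l ^ 2 * V) ^ 3) :
    Y ^ 2 ≤ V * (16 * (K - k) + 6 * P) ^ 2 / (9 * k) := by
  set q := K - k + P / 2 with hq
  have hq0 : 0 ≤ q := by linarith
  have hQ : Q = k + 3 * q := by linarith
  have hX (l : ℝ) : k + q - q ^ 2 / k ≤ K + l * Y + 4 * l ^ 2 * V :=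
    (Odd.strictMono_pow (by decide : Odd 3)).le_iff_le.1
      ((cube_le_of_nonneg hk hq0).trans (hQ ▸ hS l))
  have hd := discrim_le_zero (a := 4 * V) (b := Y) (c := K - (k + q - q ^ 2 / k))
    fun l => by linarith [hX l]
  rw [discrim] at hd
  have h1 : K - (k + q - q ^ 2 / k) ≤ q ^ 2 / k := by linarith
  have h2 : Y ^ 2 ≤ 16 * (V * (q ^ 2 / k)) := by
    nlinarith [mul_le_mul_of_nonneg_left h1 hV]
  have h3 : 16 * (V * (q ^ 2 / k)) = V * (12 * q) ^ 2 / (9 * k) := by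
    field_simp; ring
  rw [h3] at h2
  refine h2.trans ?_
  gcongr
  linarith

/-- A virial-type dichotomy: a global solution would have bounded variance and a quartic term
which is not bounded away from zero. -/
lemma virial_bounds {k : ℝ} {K P Q V Y : ℝ → ℝ} (hk : 0 < k)
    (hK : ∀ t > 0, k ≤ K t) (hP : ∀ t > 0, 0 ≤ P t) (hV : ∀ t > 0, 0 ≤ V t)
    (hE : ∀ t > 0, K t / 2 - Q t / 6 + P t / 4 = k / 3)
    (hS : ∀ t > 0, ∀ l, k ^ 2 * Q t ≤ (K t + l * Y t + 4 * l ^ 2 * V t) ^ 3)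
    (hdV : ∀ t > 0, HasDerivAt V (Y t) t)
    (hdY : ∀ t > 0, HasDerivAt Y (8 * K t + 6 * P t - 8 * Q t) t) :
    (∃ B, ∀ t ≥ 1, V t ≤ B) ∧ ∀ ε > 0, ∃ t ≥ 1, P t < ε := by
  have hdY' (t : ℝ) (ht : t > 0) : HasDerivAt Y (-(16 * (K t - k) + 6 * P t)) t := by
    convert hdY t ht using 1
    linarith [hE t ht]
  have hh (t : ℝ) (ht : t > 0) : 0 ≤ 16 * (K t - k) + 6 * P t := by
    linarith [hK t ht, hP t ht]
  have hYnonneg (s : ℝ) (hs : 0 < s) : 0 ≤ Y s := by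
    by_contra! hneg
    obtain ⟨t, ht, hVt⟩ := exists_neg_of_hasDerivAt_le (neg_pos.2 hneg)
      (fun t ht => hdV t (hs.trans_le ht)) fun t ht => by
        rw [neg_neg]
        exact le_of_hasDerivAt_nonpos (fun t ht => hdY' t (hs.trans_le ht))
          (fun t ht => neg_nonpos.2 (hh t (hs.trans_le ht))) ht
    exact hVt.not_ge (hV t (hs.trans_le ht))
  refine ⟨?_, fun ε hε => ?_⟩
  · set c := (3 * √k)⁻¹ with hc
    have hc0 : 0 < c := by positivity
    have hc2 : c ^ 2 = (9 * k)⁻¹ := by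
      rw [hc, inv_pow, mul_pow, Real.sq_sqrt hk.le]; norm_num
    have hd (t : ℝ) (ht : t ≥ 1) : HasDerivAt (fun t => √(V t + 1) + c / 2 * Y t)
        (Y t / (2 * √(V t + 1)) + c / 2 * -(16 * (K t - k) + 6 * P t)) t :=
      (((hdV t (by linarith)).add_const 1).sqrt (by linarith [hV t (by linarith)])).add
        ((hdY' t (by linarith)).const_mul _)
    have hd' (t : ℝ) (ht : t ≥ 1) :
        Y t / (2 * √(V t + 1)) + c / 2 * -(16 * (K t - k) + 6 * P t) ≤ 0 := by
      have ht0 : t > 0 := by linarith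
      have hVt := hV t ht0
      have hsq := momentum_sq_le hk (hK t ht0) (hP t ht0) hVt (hE t ht0) (hS t ht0)
      have hz : 0 < √(V t + 1) := Real.sqrt_pos.2 (by linarith)
      have hY : Y t ≤ c * √(V t + 1) * (16 * (K t - k) + 6 * P t) := by
        refine le_of_sq_le_sq ?_ (mul_nonneg (by positivity) (hh t ht0))
        rw [mul_pow, mul_pow, hc2, Real.sq_sqrt (by linarith)]
        refine hsq.trans ?_
        rw [div_eq_inv_mul, mul_assoc]
        gcongr
        linarith
      have : Y t / (2 * √(V t + 1)) ≤ c / 2 * (16 * (K t - k) + 6 * P t) := by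
        rw [div_le_iff₀ (by positivity)]
        linarith
      linarith
    refine ⟨(√(V 1 + 1) + c / 2 * Y 1) ^ 2, fun t ht => ?_⟩
    have h := le_of_hasDerivAt_nonpos hd hd' ht
    have hYt := mul_nonneg (half_pos hc0).le (hYnonneg t (by linarith))
    have hle : √(V t + 1) ≤ √(V 1 + 1) + c / 2 * Y 1 := by linarith
    have := (Real.sqrt_le_left (hle.trans' (Real.sqrt_nonneg _))).1 hle
    linarith
  · by_contra! hcon
    obtain ⟨t, ht, hYt⟩ := exists_neg_of_hasDerivAt_le (a := 1)
      (mul_pos (by norm_num : (0 : ℝ) < 6) hε)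
      (fun t ht => hdY' t (by linarith)) fun t ht => by
        linarith [hK t (by linarith), hcon t ht]
    exact hYt.not_ge (hYnonneg t (by linarith))

end VirialArgument

section Concentration

open Set Filter Topology

variable {u : smoothAlg}

lemma intS_mass_re (hu : IsSchwartz u) (t : ℝ) :
    (intS (u * conjS u) t).re = ∫ x, ‖u.1 t x‖ ^ 2 := by
  rw [intS_re (hu.mul hu.conjS)]
  simp only [mul_conjS_apply, Complex.ofReal_re]

lemma intS_quartic_re (hu : IsSchwartz u) (t : ℝ) :
    (intS (u * conjS u * (u * conjS u)) t).re = ∫ x, ‖u.1 t x‖ ^ 4 := by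
  rw [intS_re (hu.quartic hu.conjS)]
  simp only [quartic_apply, Complex.ofReal_re]

lemma intS_varianceDensity_re (hu : IsSchwartz u) (t : ℝ) :
    (intS (varianceDensity u (conjS u)) t).re = ∫ x, ‖x‖ ^ 2 * ‖u.1 t x‖ ^ 2 := by
  rw [intS_re (hu.varianceDensity hu.conjS)]
  simp only [varianceDensity_apply, Complex.ofReal_re]

lemma eq_zero_of_integral_norm_pow_eq_zero {f : E3 → ℂ} (hf : Continuous f) {n : ℕ} (hn : n ≠ 0)
    (hi : Integrable fun x => ‖f x‖ ^ n) (h : ∫ x, ‖f x‖ ^ n = 0) : f = 0 := by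
  rw [integral_eq_zero_iff_of_nonneg (fun x => by positivity) hi] at h
  have h0 := (Continuous.ae_eq_iff_eq volume (by fun_prop) continuous_zero).1 h
  ext x
  simpa [hn] using congrFun h0 x

lemma integrable_norm_sq (hu : IsSchwartz u) (t : ℝ) : Integrable fun x => ‖u.1 t x‖ ^ 2 := by
  simpa only [mul_conjS_apply, Complex.ofReal_re] using integrable_re (hu.mul hu.conjS) t

lemma integrable_norm_pow_four (hu : IsSchwartz u) (t : ℝ) :
    Integrable fun x => ‖u.1 t x‖ ^ 4 := by
  simpa only [quartic_apply, Complex.ofReal_re] using integrable_re (hu.quartic hu.conjS) t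

lemma integrable_variance (hu : IsSchwartz u) (t : ℝ) :
    Integrable fun x => ‖x‖ ^ 2 * ‖u.1 t x‖ ^ 2 := by
  simpa only [varianceDensity_apply, Complex.ofReal_re] using
    integrable_re (hu.varianceDensity hu.conjS) t

lemma integral_gradSqC_zero : ∫ x, gradSqC 0 x = 0 := by
  simp [gradSqC, pdC]

/-- The mass is controlled by the variance at infinity and by the quartic norm on balls. -/
lemma mass_le (hu : IsSchwartz u) (t : ℝ) {R e : ℝ} (hR : 0 < R) (he : 0 < e) :
    ∫ x, ‖u.1 t x‖ ^ 2 ≤ (∫ x, ‖x‖ ^ 2 * ‖u.1 t x‖ ^ 2) / R ^ 2 +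
      (e * (volume : Measure E3).real (Metric.ball 0 R) + (∫ x, ‖u.1 t x‖ ^ 4) / (4 * e)) := by
  have hV := (integrable_variance hu t).div_const (R ^ 2)
  have hP := (integrable_norm_pow_four hu t).div_const (4 * e)
  have hB : Integrable ((Metric.ball (0 : E3) R).indicator fun _ => e) :=
    (integrable_indicator_iff measurableSet_ball).2 (integrableOn_const measure_ball_lt_top.ne)
  have hBi : ∫ x, (Metric.ball (0 : E3) R).indicator (fun _ => e) x =
      e * (volume : Measure E3).real (Metric.ball 0 R) := by
    rw [integral_indicator measurableSet_ball, setIntegral_const, smul_eq_mul, mul_comm]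
  have hadd : ∫ x, (‖x‖ ^ 2 * ‖u.1 t x‖ ^ 2 / R ^ 2 +
      ((Metric.ball (0 : E3) R).indicator (fun _ => e) x + ‖u.1 t x‖ ^ 4 / (4 * e))) = _ :=
    integral_add hV (hB.add hP)
  have hadd' : ∫ x, ((Metric.ball (0 : E3) R).indicator (fun _ => e) x +
      ‖u.1 t x‖ ^ 4 / (4 * e)) = _ := integral_add hB hP
  rw [← integral_div, ← integral_div, ← hBi, ← hadd', ← hadd]
  refine integral_mono (integrable_norm_sq hu t) (hV.add (hB.add hP)) fun x => ?_
  set a := ‖u.1 t x‖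
  have h4 : 0 ≤ a ^ 4 / (4 * e) := by positivity
  by_cases hx : x ∈ Metric.ball (0 : E3) R
  · rw [indicator_of_mem hx]
    have h1 : 0 ≤ ‖x‖ ^ 2 * a ^ 2 / R ^ 2 := by positivity
    have h2 : a ^ 2 - e ≤ a ^ 4 / (4 * e) := by
      rw [le_div_iff₀ (by positivity)]
      nlinarith [sq_nonneg (a ^ 2 - 2 * e)]
    linarith
  · rw [indicator_of_notMem hx]
    have hxR : R ≤ ‖x‖ := by simpa using hx
    have h1 : a ^ 2 ≤ ‖x‖ ^ 2 * a ^ 2 / R ^ 2 := by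
      rw [le_div_iff₀ (by positivity), mul_comm]
      gcongr
    linarith

/-- Bounded variance and vanishing quartic norm force the mass to vanish. -/
lemma false_of_mass_const (hu : IsSchwartz u) {m B : ℝ} (hm : 0 < m)
    (hmass : ∀ t ≥ 1, ∫ x, ‖u.1 t x‖ ^ 2 = m)
    (hB : ∀ t ≥ 1, ∫ x, ‖x‖ ^ 2 * ‖u.1 t x‖ ^ 2 ≤ B)
    (hP : ∀ ε > 0, ∃ t ≥ 1, ∫ x, ‖u.1 t x‖ ^ 4 < ε) : False := by
  have hB0 : 0 ≤ B := (integral_nonneg fun x => by positivity).trans (hB 1 le_rfl)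
  obtain ⟨R, hR, hBR⟩ : ∃ R > 0, B / R ^ 2 ≤ m / 4 := by
    refine ⟨√(4 * B / m + 1), by positivity, ?_⟩
    rw [Real.sq_sqrt (by positivity), div_le_iff₀ (by positivity)]
    have : m / 4 * (4 * B / m + 1) = B + m / 4 := by field_simp
    linarith
  set w := (volume : Measure E3).real (Metric.ball 0 R)
  have hw : 0 ≤ w := measureReal_nonneg
  set e := m / (4 * (w + 1)) with he
  have he0 : 0 < e := by positivity
  have hew : e * w ≤ m / 4 := by
    rw [he, div_mul_eq_mul_div, div_le_iff₀ (by positivity)]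
    nlinarith
  obtain ⟨t, ht, hPt⟩ := hP (e * m) (by positivity)
  have h4 : (∫ x, ‖u.1 t x‖ ^ 4) / (4 * e) ≤ m / 4 := by
    rw [div_le_iff₀ (by positivity)]
    linarith
  have hVR : (∫ x, ‖x‖ ^ 2 * ‖u.1 t x‖ ^ 2) / R ^ 2 ≤ B / R ^ 2 := by
    gcongr
    exact hB t ht
  have h := mass_le hu t hR he0
  rw [hmass t ht] at h
  linarith

end Concentration

section Threshold

open Set

lemma eq_of_hasDerivAt_zero {f : ℝ → ℂ} (hf : ∀ t > 0, HasDerivAt f 0 t) {s t : ℝ}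
    (hs : 0 < s) (ht : 0 < t) : f t = f s :=
  isOpen_Ioi.is_const_of_deriv_eq_zero isPreconnected_Ioi
    (fun x hx => (hf x hx).differentiableAt.differentiableWithinAt)
    (fun x hx => (hf x hx).deriv) ht hs

lemma eq_apply_zero_of_hasDerivAt_zero {f : ℝ → ℂ} (hc : Continuous f)
    (hf : ∀ t > 0, HasDerivAt f 0 t) {t : ℝ} (ht : 0 ≤ t) : f t = f 0 := by
  have h : EqOn f (fun _ => f 1) (closure (Ioi 0)) :=
    EqOn.closure (fun s hs => eq_of_hasDerivAt_zero hf one_pos hs) hc continuous_const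
  rw [closure_Ioi] at h
  rw [h ht, h self_mem_Ici]

variable {u : ℝ → E3 → ℂ}

lemma IsRegularSolution.continuous_kineticEnergy (h : IsRegularSolution (Ici 0) u) :
    Continuous fun t => ∫ x, gradSqC (h.extend.1 t) x :=
  (Complex.continuous_re.comp h.continuous_intS_kinetic).congr fun t =>
    intS_kinetic_re h.isSchwartz t

lemma IsRegularSolution.energy_balance (h : IsRegularSolution (Ici 0) u)
    (hE : Ecq (u 0) = Ecrit Wc) {t : ℝ} (ht : 0 ≤ t) :
    (∫ x, gradSqC (h.extend.1 t) x) / 2 - (intS (h.extend * conjS h.extend *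
      (h.extend * conjS h.extend) * (h.extend * conjS h.extend)) t).re / 6 +
      (∫ x, ‖h.extend.1 t x‖ ^ 4) / 4 = groundKinetic / 3 := by
  have h1 := eq_apply_zero_of_hasDerivAt_zero h.continuous_intS_energyDensity
    (fun t ht => h.isNLSPair.energy_hasDerivAt ht) ht
  have h2 := congrArg Complex.re h1
  rw [intS_energyDensity_re h.isSchwartz 0, h.extend_of_nonneg le_rfl, hE, Ecrit_Wc,
    intS_energyDensity h.isSchwartz] at h2
  rw [← intS_kinetic_re h.isSchwartz, ← intS_quartic_re h.isSchwartz, ← h2]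
  simp
  ring

lemma IsRegularSolution.groundKinetic_lt (h : IsRegularSolution (Ici 0) u)
    (hrad : ∀ t x y, ‖x‖ = ‖y‖ → u t x = u t y) (hE : Ecq (u 0) = Ecrit Wc)
    (h0 : groundKinetic < ∫ x, gradSqC (u 0) x) {t : ℝ} (ht : 0 ≤ t) :
    groundKinetic < ∫ x, gradSqC (h.extend.1 t) x := by
  by_contra! hle
  rw [← h.extend_of_nonneg le_rfl] at h0
  obtain ⟨s, hs, hKs⟩ := intermediate_value_Icc' ht h.continuous_kineticEnergy.continuousOn
    ⟨hle, h0.le⟩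
  have hk := groundKinetic_pos
  have hbal := h.energy_balance hE hs.1
  have hsob := radial_sobolev_chirp h.isSchwartz (fun t => hrad _) 0 s
  simp only at hKs
  rw [intS_kinetic_re h.isSchwartz, hKs] at hsob
  rw [hKs] at hbal
  set Q := (intS (h.extend * conjS h.extend *
      (h.extend * conjS h.extend) * (h.extend * conjS h.extend)) s).re
  have hQ : Q ≤ groundKinetic := by
    refine le_of_mul_le_mul_left ?_ (pow_pos hk 2)
    linarith
  have hP : ∫ x, ‖h.extend.1 s x‖ ^ 4 = 0 :=
    le_antisymm (by linarith) (integral_nonneg fun x => by positivity)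
  rw [eq_zero_of_integral_norm_pow_eq_zero (h.extend.2 s).continuous four_ne_zero
    (integrable_norm_pow_four h.isSchwartz s) hP, integral_gradSqC_zero] at hKs
  exact hk.ne hKs

end Threshold

/-- Threshold blowup: there is no forward-global radial regular solution at
threshold energy above the ground state gradient norm. -/
theorem threshold_blowup :
    ¬ ∃ u : ℝ → E3 → ℂ, IsRegularSolution (Set.Ici 0) u ∧
      (∀ (t : ℝ) (x y : E3), ‖x‖ = ‖y‖ → u t x = u t y) ∧
      Ecq (u 0) = Ecrit Wc ∧
      (∫ x : E3, gradSqC (u 0) x) > ∫ x : E3, gradSqR W x := by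
  rintro ⟨u, h, hrad, hE, h0⟩
  rw [integral_gradSqR_W] at h0
  have hS := h.isSchwartz
  have hK {t : ℝ} (ht : 0 ≤ t) := h.groundKinetic_lt hrad hE h0 ht
  have hre {f : ℝ → ℂ} {f' : ℂ} {t : ℝ} (hf : HasDerivAt f f' t) :
      HasDerivAt (fun s => (f s).re) f'.re t :=
    Complex.reCLM.hasFDerivAt.comp_hasDerivAt t hf
  obtain ⟨⟨B, hB⟩, hP⟩ := virial_bounds groundKinetic_pos
    (K := fun t => ∫ x, gradSqC (h.extend.1 t) x) (P := fun t => ∫ x, ‖h.extend.1 t x‖ ^ 4)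
    (V := fun t => ∫ x, ‖x‖ ^ 2 * ‖h.extend.1 t x‖ ^ 2)
    (Y := fun t => (intS (momentumDensity h.extend (conjS h.extend)) t).re)
    (fun t ht => (hK (le_of_lt ht)).le) (fun t _ => integral_nonneg fun x => by positivity)
    (fun t _ => integral_nonneg fun x => by positivity)
    (fun t ht => h.energy_balance hE (le_of_lt ht))
    (fun t _ l => by
      simpa only [intS_kinetic_re hS, intS_varianceDensity_re hS] using
        radial_sobolev_chirp hS (fun t => hrad _) l t)
    (fun t ht => by
      simpa only [intS_varianceDensity_re hS] using hre (h.isNLSPair.variance_hasDerivAt ht))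
    (fun t ht => by
      have := hre (h.isNLSPair.momentum_hasDerivAt ht)
      rw [intS_virialDensity hS] at this
      simpa [intS_kinetic_re hS, intS_quartic_re hS] using this)
  have hmass (t : ℝ) (ht : t ≥ 1) :
      ∫ x, ‖h.extend.1 t x‖ ^ 2 = ∫ x, ‖h.extend.1 1 x‖ ^ 2 := by
    rw [← intS_mass_re hS, ← intS_mass_re hS, eq_of_hasDerivAt_zero
      (fun t ht => h.isNLSPair.mass_hasDerivAt ht) one_pos (one_pos.trans_le ht)]
  refine false_of_mass_const hS ?_ hmass hB hP
  refine lt_of_le_of_ne (integral_nonneg fun x => by positivity) fun hm => ?_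
  have hK1 := hK zero_le_one
  rw [eq_zero_of_integral_norm_pow_eq_zero (h.extend.2 1).continuous two_ne_zero
    (integrable_norm_sq hS 1) hm.symm, integral_gradSqC_zero] at hK1
  exact groundKinetic_pos.not_gt hK1
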